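/- arXiv:0809.4250 — 10 statements merged into one kernel-verified Lean document; each statement's English description precedes it below -/
import Mathlib

section
/- Let S be a finite set and 𝒜 = (A_1, …, A_r) a family of subsets of S that has at least one system of distinct representatives. Then the collection of transversals of 𝒜 is the collection of bases of a matroid on S; in particular it satisfies the basis exchange property: if T and T' are transversals of 𝒜 and x ∈ T − T', then there exists y ∈ T' − T such that (T − x) ∪ y is a transversal of 𝒜. -/
/-- A system of distinct representatives (SDR) of a family `A` of sets:
an injective choice of an element `a i ∈ A i` for each index `i`. -/
def IsSDR {ι S : Type*} (A : ι → Finset S) (a : ι → S) : Prop :=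
  Function.Injective a ∧ ∀ i, a i ∈ A i

/-- A transversal of the family `A` is the set of values of some SDR of `A`. -/
def IsTransversal {ι S : Type*} [DecidableEq S] [Fintype ι]
    (A : ι → Finset S) (T : Finset S) : Prop :=
  ∃ a : ι → S, IsSDR A a ∧ T = Finset.image a Finset.univ

/-- An SDR of `A` with one index `i` left out can be modified so that its set of values grows
by exactly one value of a given SDR `b` of `A`. -/
theorem exists_isTransversal_insert_image_erase {ι S : Type*} [DecidableEq S] [Fintype ι]
    [DecidableEq ι] {A : ι → Finset S} {b : ι → S} (hb : IsSDR A b) (a : ι → S) (i : ι)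
    (hinj : Set.InjOn a {i}ᶜ) (hmem : ∀ k ≠ i, a k ∈ A k) :
    ∃ j, b j ∉ (Finset.univ.erase i).image a ∧
      IsTransversal A (insert (b j) ((Finset.univ.erase i).image a)) := by
  induction h : (Finset.univ.filter fun k => k ≠ i ∧ a k ≠ b k).card using Nat.strong_induction_on
    generalizing a i with
  | _ n ih =>
  by_cases hbi : b i ∈ (Finset.univ.erase i).image a
  · obtain ⟨j, hj, hji⟩ := Finset.mem_image.1 hbi
    have hj : j ≠ i := Finset.ne_of_mem_erase hj
    have hne : a j ≠ b j := fun e => hj (hb.1 (e.symm.trans hji))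
    have himage : (Finset.univ.erase j).image (Function.update a i (b i)) =
        (Finset.univ.erase i).image a := by
      ext z
      simp only [Finset.mem_image, Finset.mem_erase, Finset.mem_univ, and_true,
        Function.update_apply]
      constructor
      · rintro ⟨k, hk, rfl⟩
        by_cases hki : k = i
        · exact ⟨j, hj, by simp [hki, hji]⟩
        · exact ⟨k, hki, by simp [hki]⟩
      · rintro ⟨k, hk, rfl⟩
        by_cases hkj : k = j
        · exact ⟨i, hj.symm, by simp [hkj, hji]⟩
        · exact ⟨k, hkj, by simp [hk]⟩
    have key := ih _ ?_ (Function.update a i (b i)) j ?_ ?_ rfl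
    · rwa [himage] at key
    · rw [← h]
      refine Finset.card_lt_card (Finset.ssubset_iff_subset_ne.2 ⟨?_, fun e => ?_⟩)
      · intro k
        simp only [Finset.mem_filter, Finset.mem_univ, true_and, Function.update_apply]
        grind
      · have : j ∈ Finset.univ.filter fun k => k ≠ i ∧ a k ≠ b k := by simp [hj, hne]
        rw [← e] at this
        simp at this
    · intro k hk l hl hkl
      have hinj' : ∀ k ≠ i, ∀ l ≠ i, a k = a l → k = l := fun k hk l hl => hinj hk hl
      simp only [Set.mem_compl_iff, Set.mem_singleton_iff] at hk hl
      simp only [Function.update_apply] at hkl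
      grind
    · intro k _
      rw [Function.update_apply]
      split_ifs with hki
      · exact hki ▸ hb.2 i
      · exact hmem k hki
  · refine ⟨i, hbi, Function.update a i (b i), ⟨?_, ?_⟩, ?_⟩
    · intro k l hkl
      have hinj' : ∀ k ≠ i, ∀ l ≠ i, a k = a l → k = l := fun k hk l hl => hinj hk hl
      have hbi' : ∀ k ≠ i, a k ≠ b i := fun k hk e =>
        hbi (Finset.mem_image.2 ⟨k, by simp [hk], e⟩)
      simp only [Function.update_apply] at hkl
      grind
    · intro k
      rw [Function.update_apply]
      split_ifs with hki
      · exact hki ▸ hb.2 i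
      · exact hmem k hki
    · rw [← Finset.insert_erase (Finset.mem_univ i), Finset.image_insert, Function.update_self,
        Finset.insert_erase (Finset.mem_univ i)]
      congr 1
      refine Finset.image_congr fun k hk => ?_
      rw [Function.update_of_ne (by simpa using hk)]

/-- If a family `𝒜 = (A_1, …, A_r)` of subsets of a finite set `S` has at least one
SDR, then the transversals of `𝒜` satisfy the basis exchange property (so they are
the bases of a matroid on `S`, the transversal matroid). -/
theorem transversals_basis_exchange {S : Type*} [DecidableEq S] [Fintype S] {r : ℕ}
    (A : Fin r → Finset S) (hSDR : ∃ a : Fin r → S, IsSDR A a)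
    (T T' : Finset S) (hT : IsTransversal A T) (hT' : IsTransversal A T')
    (x : S) (hx : x ∈ T \ T') :
    ∃ y ∈ T' \ T, IsTransversal A (insert y (T.erase x)) := by
  obtain ⟨a, ha, rfl⟩ := hT
  obtain ⟨b, hb, rfl⟩ := hT'
  obtain ⟨hxT, hxT'⟩ := Finset.mem_sdiff.1 hx
  obtain ⟨i, -, rfl⟩ := Finset.mem_image.1 hxT
  have himage : (Finset.univ.image a).erase (a i) = (Finset.univ.erase i).image a :=
    (Finset.image_erase ha.1 _ _).symm
  obtain ⟨j, hj, hT⟩ :=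
    exists_isTransversal_insert_image_erase hb a i ha.1.injOn fun k _ => ha.2 k
  rw [← himage] at hj hT
  have hbj : b j ∈ Finset.univ.image b := Finset.mem_image_of_mem b (Finset.mem_univ j)
  refine ⟨b j, Finset.mem_sdiff.2 ⟨hbj, fun hmem => hj (Finset.mem_erase.2 ⟨?_, hmem⟩)⟩, hT⟩
  exact fun e => hxT' (e ▸ hbj)
end

section
/- Let (G,B) be a planted graph on vertex set V with at least one set of |B| vertices routable to B. Then the collection of routable sets of (G,B) is the collection of bases of a matroid on V (the cotransversal matroid L(G,B)); in particular it satisfies the basis exchange property: if A and A' are routable sets and x ∈ A − A', then there exists y ∈ A' − A such that (A − x) ∪ y is routable. -/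
/-- `(G, B)` (with edge relation `E`) is a planted graph: `G` has no loops
(and, being given by a relation, no parallel edges) and every vertex of `B`
is a sink of `G`. -/
def IsPlanted {V : Type*} (E : V → V → Prop) (B : Finset V) : Prop :=
  (∀ v, ¬ E v v) ∧ ∀ b ∈ B, ∀ v, ¬ E b v

/-- `A` is routable to `B` in the directed graph with edge relation `E`:
there is a family of pairwise vertex-disjoint directed paths (one ending at each
vertex of `B`, possibly of length zero) whose set of initial vertices is `A`. -/
def Routable {V : Type*} (E : V → V → Prop) (B A : Finset V) : Prop :=
  ∃ f : V → List V,
    (∀ b ∈ B, (f b).Chain' E ∧ (f b).Nodup ∧ (f b).getLast? = some b) ∧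
    (∀ b ∈ B, ∀ c ∈ B, b ≠ c → ∀ v, v ∈ f b → v ∉ f c) ∧
    (∀ a : V, a ∈ A ↔ ∃ b ∈ B, (f b).head? = some a)

/-- `σ` restricts to a bijection from the complement of `B` to the complement of `A` that moves
every vertex along an edge of `E` or fixes it. -/
def IsLinkingMap {V : Type*} (E : V → V → Prop) (B A : Finset V) (σ : V → V) : Prop :=
  Set.InjOn σ {v | v ∉ B} ∧ (∀ v ∉ B, σ v = v ∨ E v (σ v)) ∧ ∀ w, w ∉ A ↔ ∃ v ∉ B, σ v = w

/-- Following the paths of a routing, and fixing the vertices off the paths, is a linking map. -/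
theorem Routable.exists_isLinkingMap {V : Type*} {E : V → V → Prop} {B A : Finset V}
    (h : Routable E B A) : ∃ σ, IsLinkingMap E B A σ := by
  obtain ⟨f, hf, hdisj, hA⟩ := h
  have hlast : ∀ b ∈ B, ∃ s, f b = s ++ [b] := fun b hb =>
    List.getLast?_eq_some_iff.mp (hf b hb).2.2
  have hmem : ∀ b ∈ B, b ∈ f b := fun b hb => by
    obtain ⟨s, hs⟩ := hlast b hb
    simp [hs]
  have hpath : ∀ b ∈ B, ∀ c ∈ B, ∀ v, v ∈ f b → v ∈ f c → b = c := fun b hb c hc v h1 h2 => by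
    by_contra hne
    exact hdisj b hb c hc hne v h1 h2
  have hnext : ∀ v, ∃ u, v ∉ B →
      (∃ b ∈ B, ∃ s t, f b = s ++ v :: u :: t) ∨ ((∀ b ∈ B, v ∉ f b) ∧ u = v) := by
    intro v
    by_cases hv : ∃ b ∈ B, v ∈ f b
    · obtain ⟨b, hb, hvb⟩ := hv
      obtain ⟨s, t, hst⟩ := List.append_of_mem hvb
      cases t with
      | nil =>
        refine ⟨v, fun hvB => (hvB ?_).elim⟩
        have := (hf b hb).2.2
        simp only [hst, List.getLast?_concat, Option.some.injEq] at this
        rwa [this]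
      | cons u t => exact ⟨u, fun _ => Or.inl ⟨b, hb, s, t, hst⟩⟩
    · push Not at hv
      exact ⟨v, fun _ => Or.inr ⟨hv, rfl⟩⟩
  choose σ hσ using hnext
  have succ_unique : ∀ b ∈ B, ∀ s t s' t' v u u', f b = s ++ v :: u :: t →
      f b = s' ++ v :: u' :: t' → u = u' := by
    intro b hb s t s' t' v u u' h1 h2
    have hnd := (hf b hb).2.1
    rw [h1] at hnd h2
    have hs : v ∉ s := by grind
    have ht : v ∉ u :: t := by grind
    have := (List.append_cons_inj_of_notMem hs ht).mp h2
    grind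
  have pred_unique : ∀ b ∈ B, ∀ s t s' t' v v' u, f b = s ++ v :: u :: t →
      f b = s' ++ v' :: u :: t' → v = v' := by
    intro b hb s t s' t' v v' u h1 h2
    have hnd := (hf b hb).2.1
    have h1' : f b = (s ++ [v]) ++ u :: t := by simp [h1]
    have h2' : f b = (s' ++ [v']) ++ u :: t' := by simp [h2]
    rw [h1'] at hnd h2'
    have hs : u ∉ s ++ [v] := by grind
    have ht : u ∉ t := by grind
    have := (List.append_cons_inj_of_notMem hs ht).mp h2'
    grind
  refine ⟨σ, ?_, ?_, ?_⟩
  · intro v hv v' hv' heq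
    rcases hσ v hv with ⟨b, hb, s, t, h1⟩ | ⟨h1, h2⟩ <;>
      rcases hσ v' hv' with ⟨c, hc, s', t', h1'⟩ | ⟨h1', h2'⟩
    · have hbc : b = c := hpath b hb c hc (σ v) (by simp [h1]) (by simp [h1', heq])
      subst hbc
      rw [← heq] at h1'
      exact pred_unique b hb s t s' t' v v' _ h1 h1'
    · exact (h1' b hb (by simp [h1, heq, h2'])).elim
    · exact (h1 c hc (by simp [h1', ← heq, h2])).elim
    · rw [← h2, ← h2', heq]
  · intro v hv
    rcases hσ v hv with ⟨b, hb, s, t, h1⟩ | ⟨-, h2⟩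
    · right
      have hch : (f b).IsChain E := (hf b hb).1
      rw [h1, List.isChain_append] at hch
      exact (List.isChain_cons_cons.mp hch.2.1).1
    · exact Or.inl h2
  · intro w
    constructor
    · intro hw
      by_cases hwp : ∃ b ∈ B, w ∈ f b
      · obtain ⟨b, hb, hwb⟩ := hwp
        obtain ⟨s, t, hst⟩ := List.append_of_mem hwb
        rcases List.eq_nil_or_concat s with rfl | ⟨s, v, rfl⟩
        · exact (hw ((hA w).mpr ⟨b, hb, by simp [hst]⟩)).elim
        · have hst' : f b = s ++ v :: w :: t := by simp [hst]
          have hvB : v ∉ B := by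
            intro hvB
            have hvb : v = b := hpath v hvB b hb v (hmem v hvB) (by simp [hst'])
            have hlst := (hf b hb).2.2
            have hnd := (hf b hb).2.1
            rw [hst'] at hlst hnd
            subst hvb
            have : v ∈ w :: t := by
              apply List.mem_of_getLast?
              simpa [List.getLast?_append, List.getLast?_cons_cons] using hlst
            grind
          refine ⟨v, hvB, ?_⟩
          rcases hσ v hvB with ⟨c, hc, s', t', h1⟩ | ⟨h1, -⟩
          · have hbc : b = c := hpath b hb c hc v (by simp [hst']) (by simp [h1])
            subst hbc
            exact succ_unique b hb _ _ _ _ v _ _ h1 hst'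
          · exact (h1 b hb (by simp [hst'])).elim
      · push Not at hwp
        have hwB : w ∉ B := fun hwB => hwp w hwB (hmem w hwB)
        refine ⟨w, hwB, ?_⟩
        rcases hσ w hwB with ⟨b, hb, s, t, h1⟩ | ⟨-, h2⟩
        · exact (hwp b hb (by simp [h1])).elim
        · exact h2
    · rintro ⟨v, hv, rfl⟩ hvA
      obtain ⟨c, hc, hhead⟩ := (hA _).mp hvA
      rcases hσ v hv with ⟨b, hb, s, t, h1⟩ | ⟨h1, h2⟩
      · have hbc : b = c :=
          hpath b hb c hc (σ v) (by simp [h1]) (List.mem_of_head? hhead)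
        subst hbc
        have hnd := (hf b hb).2.1
        rw [h1] at hnd hhead
        cases s <;> grind
      · rw [h2] at hhead
        exact h1 c hc (List.mem_of_head? hhead)

/-- Along orbits that have not yet reached `B`, a linking map has no collisions. -/
theorem IsLinkingMap.iterate_inj {V : Type*} {E : V → V → Prop} {B A : Finset V} {σ : V → V}
    (h : IsLinkingMap E B A σ) {a a' : V} (ha : a ∈ A) (ha' : a' ∈ A) :
    ∀ {i j : ℕ}, (∀ k < i, σ^[k] a ∉ B) → (∀ k < j, σ^[k] a' ∉ B) →
      σ^[i] a = σ^[j] a' → i = j ∧ a = a'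
  | 0, 0, _, _, heq => ⟨rfl, heq⟩
  | 0, j + 1, _, hj, heq => by
    rw [Function.iterate_succ_apply'] at heq
    exact ((h.2.2 a).mpr ⟨_, hj j j.lt_succ_self, heq.symm⟩ ha).elim
  | i + 1, 0, hi, _, heq => by
    rw [Function.iterate_succ_apply'] at heq
    exact ((h.2.2 a').mpr ⟨_, hi i i.lt_succ_self, heq⟩ ha').elim
  | i + 1, j + 1, hi, hj, heq => by
    rw [Function.iterate_succ_apply', Function.iterate_succ_apply'] at heq
    have := h.iterate_inj ha ha' (fun k hk => hi k (hk.trans i.lt_succ_self))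
      (fun k hk => hj k (hk.trans j.lt_succ_self))
      (h.1 (hi i i.lt_succ_self) (hj j j.lt_succ_self) heq)
    exact ⟨congrArg Nat.succ this.1, this.2⟩

/-- The orbits of a linking map that start in `A` form a routing. -/
theorem IsLinkingMap.routable {V : Type*} [DecidableEq V] [Fintype V] {E : V → V → Prop}
    {B A : Finset V} {σ : V → V} (h : IsLinkingMap E B A σ) : Routable E B A := by
  classical
  have hreach : ∀ a ∈ A, ∃ n, σ^[n] a ∈ B := by
    intro a ha
    by_contra! hnot
    obtain ⟨i, j, hij, heq⟩ := Finite.exists_ne_map_eq_of_infinite fun n : ℕ => σ^[n] a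
    exact hij (h.iterate_inj ha ha (fun k _ => hnot k) (fun k _ => hnot k) heq).1
  have hlen : ∀ a, ∃ n, a ∈ A → σ^[n] a ∈ B ∧ ∀ k < n, σ^[k] a ∉ B := fun a => by
    by_cases ha : a ∈ A
    · exact ⟨Nat.find (hreach a ha), fun _ =>
        ⟨Nat.find_spec (hreach a ha), fun k hk => Nat.find_min (hreach a ha) hk⟩⟩
    · exact ⟨0, fun h => (ha h).elim⟩
  choose N hN using hlen
  have hinj : ∀ a ∈ A, ∀ a' ∈ A, ∀ i ≤ N a, ∀ j ≤ N a', σ^[i] a = σ^[j] a' →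
      i = j ∧ a = a' := fun a ha a' ha' i hi j hj heq =>
    h.iterate_inj ha ha' (fun k hk => (hN a ha).2 k (hk.trans_le hi))
      (fun k hk => (hN a' ha').2 k (hk.trans_le hj)) heq
  have hcompl : Bᶜ.image σ = Aᶜ := by
    ext w
    simp [h.2.2 w]
  have hcard : B.card ≤ A.card := by
    have hc : (Bᶜ.image σ).card = Bᶜ.card :=
      Finset.card_image_of_injOn (by simpa [Set.InjOn] using h.1)
    rw [hcompl, Finset.card_compl, Finset.card_compl] at hc
    have := A.card_le_univ
    have := B.card_le_univ
    omega
  have hsurj : ∀ b ∈ B, ∃ a ∈ A, σ^[N a] a = b := by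
    have := Finset.surj_on_of_inj_on_of_card_le (s := A) (t := B) (fun a _ => σ^[N a] a)
      (fun a ha => (hN a ha).1)
      (fun a a' ha ha' heq => (hinj a ha a' ha' _ le_rfl _ le_rfl heq).2) hcard
    intro b hb
    obtain ⟨a, ha, hab⟩ := this b hb
    exact ⟨a, ha, hab.symm⟩
  have hstart : ∀ b, ∃ a, b ∈ B → a ∈ A ∧ σ^[N a] a = b := fun b => by
    by_cases hb : b ∈ B
    · obtain ⟨a, ha, hab⟩ := hsurj b hb
      exact ⟨a, fun _ => ⟨ha, hab⟩⟩
    · exact ⟨b, fun h => (hb h).elim⟩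
  choose g hg using hstart
  refine ⟨fun b => (List.range (N (g b) + 1)).map fun i => σ^[i] (g b), ?_, ?_, ?_⟩
  · intro b hb
    obtain ⟨ha, hab⟩ := hg b hb
    refine ⟨?_, ?_, ?_⟩
    · change List.IsChain _ _
      rw [List.isChain_iff_getElem]
      intro i hi
      simp only [List.length_map, List.length_range] at hi
      simp only [List.getElem_map, List.getElem_range]
      rcases h.2.1 _ ((hN _ ha).2 i (by omega)) with heq | hE
      · rw [← Function.iterate_succ_apply' σ] at heq
        have := (hinj _ ha _ ha (i + 1) (by omega) i (by omega) heq).1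
        omega
      · rwa [Function.iterate_succ_apply']
    · refine List.Nodup.map_on ?_ List.nodup_range
      intro i hi j hj heq
      rw [List.mem_range] at hi hj
      exact (hinj _ ha _ ha i (by omega) j (by omega) heq).1
    · simp [List.range_succ, hab]
  · intro b hb c hc hbc v hv hv'
    simp only [List.mem_map, List.mem_range] at hv hv'
    obtain ⟨i, hi, rfl⟩ := hv
    obtain ⟨j, hj, heq⟩ := hv'
    have := (hinj _ (hg c hc).1 _ (hg b hb).1 j (by omega) i (by omega) heq).2
    apply hbc
    rw [← (hg b hb).2, ← (hg c hc).2, this]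
  · intro a
    simp only [List.head?_map, List.head?_range]
    constructor
    · intro ha
      refine ⟨_, (hN a ha).1, ?_⟩
      have hga := hg _ (hN a ha).1
      have := (hinj _ hga.1 a ha _ le_rfl _ le_rfl hga.2).2
      simp [this]
    · rintro ⟨b, hb, hba⟩
      have : g b = a := by simpa using hba
      exact this ▸ (hg b hb).1

/-- Exchange for linking maps, by following an alternating path of the two maps. -/
theorem IsLinkingMap.exchange {V : Type*} [DecidableEq V] [Fintype V] {E : V → V → Prop}
    {B A' : Finset V} {σ' : V → V} (h' : IsLinkingMap E B A' σ') (A : Finset V) (σ : V → V)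
    (h : IsLinkingMap E B A σ) (x : V) (hx : x ∈ A) (hx' : x ∉ A') :
    ∃ y, y ∈ A' ∧ y ∉ A ∧ ∃ τ, IsLinkingMap E B (insert y (A.erase x)) τ := by
  obtain ⟨u, hu, hux⟩ := (h'.2.2 x).mp hx'
  have hσu : σ u ∉ A := (h.2.2 _).mpr ⟨u, hu, rfl⟩
  have hne : σ u ≠ x := fun heq => hσu (heq ▸ hx)
  have hupd : IsLinkingMap E B (insert (σ u) (A.erase x)) (Function.update σ u x) := by
    refine ⟨?_, ?_, ?_⟩
    · intro v hv w hw heq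
      have hmiss : ∀ z ∉ B, σ z ≠ x := fun z hz hzx => (h.2.2 x).mpr ⟨z, hz, hzx⟩ hx
      by_cases hvu : v = u <;> by_cases hwu : w = u
      · rw [hvu, hwu]
      · subst hvu
        rw [Function.update_self, Function.update_of_ne hwu] at heq
        exact (hmiss w hw heq.symm).elim
      · subst hwu
        rw [Function.update_self, Function.update_of_ne hvu] at heq
        exact (hmiss v hv heq).elim
      · rw [Function.update_of_ne hvu, Function.update_of_ne hwu] at heq
        exact h.1 hv hw heq
    · intro v hv
      by_cases hvu : v = u
      · subst hvu
        rw [Function.update_self, ← hux]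
        exact h'.2.1 v hv
      · rw [Function.update_of_ne hvu]
        exact h.2.1 v hv
    · intro w
      simp only [Finset.mem_insert, Finset.mem_erase, not_or, not_and_or, not_not]
      constructor
      · rintro ⟨hwu, rfl | hwA⟩
        · exact ⟨u, hu, Function.update_self ..⟩
        · obtain ⟨v, hv, rfl⟩ := (h.2.2 w).mp hwA
          exact ⟨v, hv, Function.update_of_ne (fun hvu => hwu (congrArg σ hvu)) ..⟩
      · rintro ⟨v, hv, rfl⟩
        by_cases hvu : v = u
        · subst hvu
          rw [Function.update_self]
          exact ⟨hne.symm, Or.inl rfl⟩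
        · rw [Function.update_of_ne hvu]
          exact ⟨fun heq => hvu (h.1 hv hu heq), Or.inr ((h.2.2 _).mpr ⟨v, hv, rfl⟩)⟩
  by_cases hy : σ u ∈ A'
  · exact ⟨σ u, hy, hσu, _, hupd⟩
  · have hdec : (Finset.univ.filter fun v => Function.update σ u x v ≠ σ' v).card <
        (Finset.univ.filter fun v => σ v ≠ σ' v).card := by
      refine Finset.card_lt_card (Finset.ssubset_iff_of_subset ?_ |>.mpr ⟨u, ?_, ?_⟩)
      · intro v hv
        simp only [Finset.mem_filter, Finset.mem_univ, true_and] at hv ⊢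
        have hvu : v ≠ u := by
          rintro rfl
          exact hv (by rw [Function.update_self, hux])
        rwa [Function.update_of_ne hvu] at hv
      · simpa [hux] using hne
      · simp [hux]
    obtain ⟨y, hyA', hyA, τ, hτ⟩ := h'.exchange _ _ hupd (σ u) (Finset.mem_insert_self ..) hy
    have hyx : y ≠ x := fun heq => hx' (heq ▸ hyA')
    refine ⟨y, hyA', fun hA => hyA (by simp [hA, hyx]), τ, ?_⟩
    rwa [Finset.erase_insert (fun hmem => hσu (Finset.mem_of_mem_erase hmem))] at hτ
termination_by (Finset.univ.filter fun v => σ v ≠ σ' v).card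

/-- If a planted graph `(G,B)` has at least one routable set, then the routable sets
satisfy the basis exchange property (so they are the bases of a matroid on `V`, the
cotransversal matroid `L(G,B)`). -/
theorem routable_basis_exchange {V : Type*} [DecidableEq V] [Fintype V]
    (E : V → V → Prop) (B : Finset V) (hPl : IsPlanted E B)
    (hne : ∃ A : Finset V, Routable E B A)
    (A A' : Finset V) (hA : Routable E B A) (hA' : Routable E B A')
    (x : V) (hx : x ∈ A \ A') :
    ∃ y ∈ A' \ A, Routable E B (insert y (A.erase x)) := by
  obtain ⟨hxA, hxA'⟩ := Finset.mem_sdiff.mp hx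
  obtain ⟨σ, hσ⟩ := hA.exists_isLinkingMap
  obtain ⟨σ', hσ'⟩ := hA'.exists_isLinkingMap
  obtain ⟨y, hyA', hyA, τ, hτ⟩ := hσ'.exchange A σ hσ x hxA hxA'
  exact ⟨y, Finset.mem_sdiff.mpr ⟨hyA', hyA⟩, hτ.routable⟩
end

section
/- Let (G,B) be a planted graph, and let i ∉ B, j ∈ B be vertices such that the edge e_{ij} from i to j is in G. Then the planted graph (G,B)_{i→j} = (G',B') obtained by the operation swap(i,j) has exactly the same routable sets as (G,B); that is, a set A of |B| vertices is routable to B in (G,B) if and only if A is routable to B' in (G',B'). -/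
/-- The edge relation of the graph obtained from `E` by `swap(i,j)`:
the edge `e_{ij}` is replaced by `e_{ji}`, every other edge `e_{ik}` out of `i`
is replaced by `e_{jk}`, and all other edges are unchanged.  (In particular `i`
becomes a sink; `j` had no outgoing edges since it was a sink.) -/
def swapGraph {V : Type*} (E : V → V → Prop) (i j : V) : V → V → Prop :=
  fun x y => (x ≠ i ∧ x ≠ j ∧ E x y) ∨ (x = j ∧ (y = i ∨ (E i y ∧ y ≠ j)))

theorem List.IsChain.swapGraph_of_notMem {V : Type*} {E : V → V → Prop} {i j : V} {l : List V}
    (hj : ∀ v, ¬ E j v) (hl : l.IsChain E) (hi : i ∉ l) : l.IsChain (swapGraph E i j) := by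
  induction l with
  | nil => simp
  | cons a l ih =>
    rw [List.isChain_cons] at hl ⊢
    refine ⟨fun y hy => Or.inl ⟨?_, ?_, hl.1 y hy⟩, ih hl.2 (by grind)⟩
    · rintro rfl
      simp at hi
    · rintro rfl
      exact hj _ (hl.1 y hy)

theorem List.IsChain.swapGraph_append_singleton {V : Type*} {E : V → V → Prop} {i j : V}
    {l : List V} (hj : ∀ v, ¬ E j v) (hl : (l ++ [i]).IsChain E) (hi : i ∉ l) :
    (l ++ [i]).IsChain (swapGraph E i j) := by
  rw [List.isChain_append] at hl ⊢
  refine ⟨hl.1.swapGraph_of_notMem hj hi, by simp,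
    fun x hx y hy => Or.inl ⟨?_, ?_, hl.2.2 x hx y hy⟩⟩
  · rintro rfl
    exact hi (List.mem_of_mem_getLast? hx)
  · rintro rfl
    exact hj _ (hl.2.2 x hx y hy)

/-- If no path of a routing meets `i`, the path ending at `j` extends along the edge from `j` to `i`
in the swapped graph. -/
theorem routable_swapGraph_of_notMem {V : Type*} [DecidableEq V] {E : V → V → Prop}
    {B A : Finset V} {i j : V} (hjs : ∀ v, ¬ E j v) (hi : i ∉ B) (hj : j ∈ B) {f : V → List V}
    (hf : ∀ b ∈ B, (f b).IsChain E ∧ (f b).Nodup ∧ (f b).getLast? = some b)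
    (hd : ∀ b ∈ B, ∀ c ∈ B, b ≠ c → ∀ v, v ∈ f b → v ∉ f c)
    (hA : ∀ a : V, a ∈ A ↔ ∃ b ∈ B, (f b).head? = some a) (hex : ∀ b ∈ B, i ∉ f b) :
    Routable (swapGraph E i j) (insert i (B.erase j)) A := by
  have hfj : f j ≠ [] := fun h => by
    have := (hf j hj).2.2
    simp [h] at this
  have hjh : (f j ++ [i]).head? = (f j).head? := List.head?_append_of_ne_nil _ hfj
  refine ⟨fun v => if v = i then f j ++ [i] else f v, ?_, ?_, ?_⟩
  · intro c hc'
    by_cases hci : c = i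
    · simp only [hci, if_true]
      refine ⟨?_, ?_, by simp⟩
      · refine List.isChain_append.2
          ⟨(hf j hj).1.swapGraph_of_notMem hjs (hex j hj), by simp, ?_⟩
        intro x hx y hy
        rw [(hf j hj).2.2] at hx
        exact Or.inr ⟨by simpa using hx.symm, Or.inl (by simpa using hy.symm)⟩
      · have := hex j hj
        have := (hf j hj).2.1
        grind
    · have hcB : c ∈ B := by grind
      simp only [hci, if_false]
      exact ⟨(hf c hcB).1.swapGraph_of_notMem hjs (hex c hcB), (hf c hcB).2⟩
  · intro c hc' d hd' hcd v hv hv'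
    have hcB : c = i ∨ c ≠ j ∧ c ∈ B := by simpa using hc'
    have hdB : d = i ∨ d ≠ j ∧ d ∈ B := by simpa using hd'
    have hdj := hd j hj
    dsimp only at hv hv'
    split_ifs at hv hv' with h1 h2 h2
    · exact hcd (h1.trans h2.symm)
    · obtain ⟨hdj', hdB⟩ := hdB.resolve_left h2
      rcases List.mem_append.1 hv with h | h
      · exact hdj d hdB hdj'.symm v h hv'
      · exact hex d hdB (List.mem_singleton.1 h ▸ hv')
    · obtain ⟨hcj', hcB⟩ := hcB.resolve_left h1
      rcases List.mem_append.1 hv' with h | h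
      · exact hdj c hcB hcj'.symm v h hv
      · exact hex c hcB (List.mem_singleton.1 h ▸ hv)
    · exact hd c (hcB.resolve_left h1).2 d (hdB.resolve_left h2).2 hcd v hv hv'
  · intro a
    rw [hA]
    constructor
    · rintro ⟨c, hc', h⟩
      by_cases hcj : c = j
      · exact ⟨i, by simp, by grind⟩
      · exact ⟨c, by grind, by grind⟩
    · rintro ⟨c, hc', h⟩
      by_cases hci : c = i
      · exact ⟨j, hj, by grind⟩
      · exact ⟨c, by grind, by grind⟩

theorem Routable.swapGraph {V : Type*} [DecidableEq V] {E : V → V → Prop} {B A : Finset V}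
    {i j : V} (hPl : IsPlanted E B) (hi : i ∉ B) (hj : j ∈ B) (h : Routable E B A) :
    Routable (swapGraph E i j) (insert i (B.erase j)) A := by
  obtain ⟨f, hf, hd, hA⟩ := h
  replace hf : ∀ b ∈ B, (f b).IsChain E ∧ (f b).Nodup ∧ (f b).getLast? = some b := hf
  have hdis : ∀ v, ∀ b ∈ B, ∀ c ∈ B, v ∈ f b → v ∈ f c → b = c := fun v b hb c hc h1 h2 =>
    by_contra fun h => hd b hb c hc h v h1 h2
  have hjs : ∀ v, ¬ E j v := hPl.2 j hj
  have hjj : j ∈ f j := List.mem_of_mem_getLast? (hf j hj).2.2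
  have hhead : ∀ b ∈ B, f b ≠ [] := by
    intro b hb h
    have := (hf b hb).2.2
    simp [h] at this
  by_cases hex : ∃ b ∈ B, i ∈ f b
  · obtain ⟨b, hb, hib⟩ := hex
    obtain ⟨q, s, hqs⟩ := List.append_of_mem hib
    obtain ⟨hc, hnd, hlast⟩ := hf b hb
    have hqs' : f b = (q ++ [i]) ++ s := by simp [hqs]
    have hiq : i ∉ q := by
      rw [hqs] at hnd
      grind
    have his : i ∉ s := by
      rw [hqs] at hnd
      grind
    have hcq : (q ++ [i]).IsChain E := by
      have := hc
      rw [hqs', List.isChain_append] at this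
      exact this.1
    have hndq : (q ++ [i]).Nodup := by
      rw [hqs'] at hnd
      exact hnd.of_append_left
    have hq := hcq.swapGraph_append_singleton hjs hiq
    have hheadq : (q ++ [i]).head? = (f b).head? := by
      rw [hqs']
      cases q <;> simp
    by_cases hbj : b = j
    · subst hbj
      refine ⟨fun v => if v = i then q ++ [i] else f v, ?_, ?_, ?_⟩
      · intro c hc'
        by_cases hci : c = i
        · simp only [hci, if_true]
          exact ⟨hq, hndq, by simp⟩
        · have hcB : c ∈ B ∧ c ≠ b := by grind
          simp only [hci, if_false]
          exact ⟨(hf c hcB.1).1.swapGraph_of_notMem hjs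
            (hd b hb c hcB.1 hcB.2.symm i hib), (hf c hcB.1).2⟩
      · intro c hc' d hd' hcd v hv hv'
        have hqb : v ∈ q ++ [i] → v ∈ f b := fun h => hqs' ▸ List.mem_append_left _ h
        have hcB : c = i ∨ c ≠ b ∧ c ∈ B := by simpa using hc'
        have hdB : d = i ∨ d ≠ b ∧ d ∈ B := by simpa using hd'
        have hcb := hdis v c
        have hdb := hdis v d
        clear hqs hqs' hc hnd hlast hcq hndq hheadq hq hf hA hd hhead
        dsimp only at hv hv'
        split_ifs at hv hv' <;> grind
      · intro a
        rw [hA]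
        constructor
        · rintro ⟨c, hc', h⟩
          by_cases hcb : c = b
          · exact ⟨i, by simp, by simp [hheadq, ← hcb, h]⟩
          · exact ⟨c, by grind, by grind⟩
        · rintro ⟨c, hc', h⟩
          by_cases hci : c = i
          · exact ⟨b, hb, by grind⟩
          · exact ⟨c, by grind, by grind⟩
    · have hij' : ∀ v ∈ f j, v ∉ f b := hd j hj b hb (Ne.symm hbj)
      have hs : s ≠ [] := by
        rintro rfl
        rw [hqs] at hlast
        simp at hlast
        exact hi (hlast ▸ hb)
      have hcs := hc
      rw [hqs', List.isChain_append] at hcs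
      have hjs' : (f j ++ s).IsChain (_root_.swapGraph E i j) := by
        rw [List.isChain_append]
        refine ⟨(hf j hj).1.swapGraph_of_notMem hjs (fun h => hij' i h hib),
          hcs.2.1.swapGraph_of_notMem hjs his, ?_⟩
        intro x hx y hy
        rw [(hf j hj).2.2] at hx
        refine Or.inr ⟨by simpa using hx.symm, Or.inr ⟨hcs.2.2 i (by simp) y hy, ?_⟩⟩
        rintro rfl
        exact hij' _ hjj (by rw [hqs']; exact List.mem_append_right _ (List.mem_of_mem_head? hy))
      have hnds : (f j ++ s).Nodup := by
        rw [List.nodup_append']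
        refine ⟨(hf j hj).2.1, ?_, ?_⟩
        · rw [hqs'] at hnd
          exact hnd.of_append_right
        · intro v hv hvs
          exact hij' v hv (by simp [hqs, hvs])
      have hlasts : (f j ++ s).getLast? = some b := by
        rw [← hlast, hqs', List.getLast?_append_of_ne_nil _ hs, List.getLast?_append_of_ne_nil _ hs]
      have hheads : (f j ++ s).head? = (f j).head? := List.head?_append_of_ne_nil _ (hhead j hj)
      have hqsd : ∀ v ∈ q ++ [i], v ∉ s := by
        rw [hqs', List.nodup_append'] at hnd
        exact fun v hv hvs => hnd.2.2 hv hvs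
      have hmem : ∀ v, v ∈ f b ↔ v ∈ q ++ [i] ∨ v ∈ s := fun v => by
        rw [hqs', List.mem_append]
      refine ⟨fun v => if v = i then q ++ [i] else if v = b then f j ++ s else f v, ?_, ?_, ?_⟩
      · intro c hc'
        by_cases hci : c = i
        · simp only [hci, if_true]
          exact ⟨hq, hndq, by simp⟩
        by_cases hcb : c = b
        · subst hcb
          simp only [hci, if_false, if_true]
          exact ⟨hjs', hnds, hlasts⟩
        · have hcB : c ∈ B := by grind
          simp only [hci, hcb, if_false]
          exact ⟨(hf c hcB).1.swapGraph_of_notMem hjs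
            (hd b hb c hcB (Ne.symm hcb) i hib), (hf c hcB).2⟩
      · have key : ∀ c ∈ insert i (B.erase j), ∀ v,
            v ∈ (if c = i then q ++ [i] else if c = b then f j ++ s else f c) →
            (c = i ∧ v ∈ q ++ [i]) ∨ (c = b ∧ v ∈ f j) ∨ (c = b ∧ v ∈ s) ∨
            (c ∈ B ∧ c ≠ j ∧ c ≠ b ∧ v ∈ f c) := by
          intro c hc' v hv
          split_ifs at hv with h1 h2
          · exact Or.inl ⟨h1, hv⟩
          · rw [List.mem_append] at hv
            tauto
          · have : c ∈ B ∧ c ≠ j := by grind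
            tauto
        intro c hc' d hd' hcd v hv hv'
        have hbv := hmem v
        have hqv := hqsd v
        replace hdis := hdis v
        rcases key c hc' v hv with h1 | h1 | h1 | h1 <;>
        rcases key d hd' v hv' with h2 | h2 | h2 | h2 <;> grind
      · intro a
        rw [hA]
        constructor
        · rintro ⟨c, hc', h⟩
          by_cases hcb : c = b
          · exact ⟨i, by simp, by simp [hheadq, ← hcb, h]⟩
          by_cases hcj : c = j
          · exact ⟨b, by grind, by grind⟩
          · exact ⟨c, by grind, by grind⟩
        · rintro ⟨c, hc', h⟩
          by_cases hci : c = i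
          · exact ⟨b, hb, by grind⟩
          by_cases hcb : c = b
          · exact ⟨j, hj, by grind⟩
          · exact ⟨c, by grind, by grind⟩
  · exact routable_swapGraph_of_notMem hjs hi hj hf hd hA fun b hb h => hex ⟨b, hb, h⟩

theorem IsPlanted.swapGraph {V : Type*} [DecidableEq V] {E : V → V → Prop} {B : Finset V}
    {i j : V} (hPl : IsPlanted E B) (hne : i ≠ j) :
    IsPlanted (swapGraph E i j) (insert i (B.erase j)) := by
  have h1 := hPl.1
  have h2 := hPl.2
  unfold _root_.swapGraph
  constructor <;> grind

theorem swapGraph_swapGraph {V : Type*} {E : V → V → Prop} {i j : V} (hi : ¬ E i i)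
    (hj : ∀ v, ¬ E j v) (hij : E i j) : swapGraph (swapGraph E i j) j i = E := by
  funext x y
  have := hj y
  simp only [swapGraph, eq_iff_iff]
  grind

/-- Swaps preserve the cotransversal matroid: if `(G,B)` is a planted graph,
`i ∉ B`, `j ∈ B` and `e_{ij} ∈ G`, then the planted graph `(G,B)_{i→j} = (G',B')`
obtained by `swap(i,j)` (with `B' = (B − j) ∪ i`) has exactly the same routable
sets as `(G,B)`. -/
theorem swap_preserves_routable {V : Type*} [DecidableEq V] [Fintype V]
    (E : V → V → Prop) (B : Finset V) (hPl : IsPlanted E B)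
    (i j : V) (hi : i ∉ B) (hj : j ∈ B) (hij : E i j)
    (A : Finset V) :
    Routable E B A ↔ Routable (swapGraph E i j) (insert i (B.erase j)) A := by
  have hne : i ≠ j := fun h => hi (h ▸ hj)
  refine ⟨Routable.swapGraph hPl hi hj, fun h => ?_⟩
  have h' := h.swapGraph (i := j) (j := i) (hPl.swapGraph hne) (by simp [hne.symm]) (by simp)
  have hB : insert j ((insert i (B.erase j)).erase i) = B := by
    ext v
    grind
  rwa [swapGraph_swapGraph (hPl.1 i) (hPl.2 j hj) hij, hB] at h'
end

section
/- Let (G,B) be a planted graph on vertex set V, and for each i ∈ V − B define A_i := {i} ∪ {u ∈ V : e_{iu} ∈ G}. Then a set T ⊆ V is a transversal of the family 𝒜 = (A_i)_{i ∈ V−B} if and only if its complement V − T is routable to B in (G,B). In particular, the assignment i ↦ i is an SDR of 𝒜, and the transversal matroid of 𝒜 is the dual of the cotransversal matroid L(G,B). -/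
/-- Two chains of a right-unique relation which start at the same vertex and end at terminal
vertices coincide. -/
theorem List.IsChain.eq_of_head?_eq {α : Type*} {R : α → α → Prop}
    (hR : ∀ x y z, R x y → R x z → y = z) {b c : α} (hb : ∀ y, ¬ R b y) (hc : ∀ y, ¬ R c y) :
    ∀ {l m : List α}, l.IsChain R → m.IsChain R → l.getLast? = some b → m.getLast? = some c →
      l.head? = m.head? → l = m
  | [], _, _, _, h, _, _ => by simp at h
  | _ :: _, [], _, _, _, h, _ => by simp at h
  | [x], [y], _, _, _, _, h => by simpa using h
  | [x], y :: z :: m, _, hm, hl', _, h => by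
    simp only [List.isChain_cons_cons] at hm
    simp at hl' h
    subst hl' h
    exact absurd hm.1 (hb _)
  | x :: z :: l, [y], hl, _, _, hm', h => by
    simp only [List.isChain_cons_cons] at hl
    simp at hm' h
    subst hm' h
    exact absurd hl.1 (hc _)
  | x :: z :: l, y :: w :: m, hl, hm, hl', hm', h => by
    simp only [List.isChain_cons_cons] at hl hm
    obtain rfl : x = y := by simpa using h
    obtain rfl := hR x z w hl.1 hm.1
    rw [List.getLast?_cons_cons] at hl' hm'
    rw [List.IsChain.eq_of_head?_eq hR hb hc hl.2 hm.2 hl' hm' rfl]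

/-- A chain of a right-unique relation which ends at a terminal vertex has no repetition. -/
theorem List.IsChain.nodup_of_terminal {α : Type*} {R : α → α → Prop}
    (hR : ∀ x y z, R x y → R x z → y = z) {b : α} (hb : ∀ y, ¬ R b y) :
    ∀ {l : List α}, l.IsChain R → l.getLast? = some b → l.Nodup
  | [], _, _ => List.nodup_nil
  | [x], _, _ => List.nodup_singleton x
  | x :: y :: l, hl, hl' => by
    have ht : (y :: l).IsChain R := (List.isChain_cons_cons.1 hl).2
    have ht' : (y :: l).getLast? = some b := by rwa [List.getLast?_cons_cons] at hl'
    refine List.nodup_cons.2 ⟨fun hx => ?_, ht.nodup_of_terminal hR hb ht'⟩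
    obtain ⟨s, t, hst⟩ := List.append_of_mem hx
    have h : x :: t = x :: y :: l := by
      rw [hst] at ht ht'
      refine List.IsChain.eq_of_head?_eq hR hb hb ht.right_of_append hl ?_ hl' rfl
      rwa [List.getLast?_append_of_ne_nil _ (by simp)] at ht'
    have := congrArg List.length h
    have := congrArg List.length hst
    simp at *
    omega

/-- In a planted graph, following an SDR of the family backwards from `B` routes the complement of
its transversal to `B`. -/
theorem IsTransversal.routable_compl {V : Type*} [DecidableEq V] [Fintype V]
    {E : V → V → Prop} {B : Finset V} (hPl : IsPlanted E B)
    {A : {v : V // v ∉ B} → Finset V}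
    (hA : ∀ i : {v : V // v ∉ B}, ∀ u : V, u ∈ A i ↔ (u = i.1 ∨ E i.1 u))
    {T : Finset V} (hT : IsTransversal A T) : Routable E B Tᶜ := by
  obtain ⟨a, ⟨hinj, hmem⟩, rfl⟩ := hT
  let R : V → V → Prop := fun x y => E x y ∧ ∃ h : x ∉ B, a ⟨x, h⟩ = y
  have hR : ∀ x y z, R x y → R x z → y = z := by
    rintro x y z ⟨-, h, rfl⟩ ⟨-, _, rfl⟩
    rfl
  have hB : ∀ b ∈ B, ∀ y, ¬ R b y := fun b hb y h => h.2.1 hb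
  have key : ∀ b ∈ B, ∃ l : List V, l.IsChain R ∧ l.getLast? = some b ∧
      ∃ x, l.head? = some x ∧ x ∉ Finset.image a Finset.univ := by
    intro b hb
    by_contra! hno
    have hlong : ∀ n : ℕ, ∃ l : List V, l.IsChain R ∧ l.getLast? = some b ∧ l.length = n + 1 := by
      intro n
      induction n with
      | zero => exact ⟨[b], by simp⟩
      | succ n ih =>
        obtain ⟨l, hl, hl', hn⟩ := ih
        obtain ⟨x, l, rfl⟩ := List.exists_cons_of_length_eq_add_one hn
        obtain ⟨i, -, hi⟩ := Finset.mem_image.1 (hno _ hl hl' x rfl)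
        refine ⟨i.1 :: x :: l, List.isChain_cons_cons.2 ⟨⟨?_, i.2, hi⟩, hl⟩, ?_, by simpa using hn⟩
        · refine ((hA i x).1 (hi ▸ hmem i)).resolve_left ?_
          rintro rfl
          cases l with
          | nil =>
            have : i.1 = b := by simpa using hl'
            exact i.2 (this ▸ hb)
          | cons y l =>
            obtain ⟨hE, _, h⟩ := (List.isChain_cons_cons.1 hl).1
            exact hPl.1 i.1 (by rwa [← h, hi] at hE)
        · rwa [List.getLast?_cons_cons]
    obtain ⟨l, hl, hl', hn⟩ := hlong (Fintype.card V)
    have := (hl.nodup_of_terminal hR (hB b hb) hl').length_le_card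
    omega
  choose! f hf hlast s hs hsT using key
  have hdisj : ∀ b ∈ B, ∀ c ∈ B, ∀ v, v ∈ f b → v ∈ f c → b = c := by
    intro b hb c hc v hvb hvc
    obtain ⟨p, q, hpq⟩ := List.append_of_mem hvb
    obtain ⟨p', q', hpq'⟩ := List.append_of_mem hvc
    have h1 := hf b hb
    have h2 := hf c hc
    have h3 := hlast b hb
    have h4 := hlast c hc
    rw [hpq] at h1 h3
    rw [hpq'] at h2 h4
    rw [List.getLast?_append_of_ne_nil _ (by simp)] at h3 h4
    have h := List.IsChain.eq_of_head?_eq hR (hB b hb) (hB c hc) h1.right_of_append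
      h2.right_of_append h3 h4 rfl
    rw [h, h4] at h3
    exact (Option.some.inj h3).symm
  have hsinj : Set.InjOn s B := fun b hb c hc h =>
    hdisj b hb c hc (s b) (List.mem_of_mem_head? (hs b hb))
      (h ▸ List.mem_of_mem_head? (hs c hc))
  have himage : B.image s = (Finset.image a Finset.univ)ᶜ := by
    refine Finset.eq_of_subset_of_card_le ?_ ?_
    · intro x hx
      obtain ⟨b, hb, rfl⟩ := Finset.mem_image.1 hx
      exact Finset.mem_compl.2 (hsT b hb)
    · rw [Finset.card_image_of_injOn hsinj, Finset.card_compl,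
        Finset.card_image_of_injective _ hinj, Finset.card_univ, Fintype.card_subtype_compl]
      simp only [Fintype.card_coe]
      omega
  refine ⟨f, fun b hb => ⟨(hf b hb).imp fun _ _ h => h.1,
    (hf b hb).nodup_of_terminal hR (hB b hb) (hlast b hb), hlast b hb⟩,
    fun b hb c hc hbc v hvb hvc => hbc (hdisj b hb c hc v hvb hvc), fun x => ?_⟩
  rw [← himage, Finset.mem_image]
  refine exists_congr fun b => and_congr_right fun hb => ?_
  rw [hs b hb, Option.some_inj]

/-- In a planted graph, a routing of the complement of `T` makes `T` a transversal: each vertex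
on a path is represented by its successor, every other vertex by itself. -/
theorem Routable.isTransversal_of_compl {V : Type*} [DecidableEq V] [Fintype V]
    {E : V → V → Prop} {B : Finset V} (hPl : IsPlanted E B)
    {A : {v : V // v ∉ B} → Finset V}
    (hA : ∀ i : {v : V // v ∉ B}, ∀ u : V, u ∈ A i ↔ (u = i.1 ∨ E i.1 u))
    {T : Finset V} (hT : Routable E B Tᶜ) : IsTransversal A T := by
  obtain ⟨f, hf, hdisj, hhead⟩ := hT
  let S : V → V → Prop := fun x y => ∃ b ∈ B, ∃ k : ℕ, (f b)[k]? = some x ∧ (f b)[k + 1]? = some y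
  have hpos : ∀ {b c : V} {k m : ℕ} {v : V}, b ∈ B → c ∈ B → (f b)[k]? = some v →
      (f c)[m]? = some v → b = c ∧ k = m := by
    intro b c k m v hb hc hk hm
    obtain rfl : b = c := by
      by_contra h
      exact hdisj b hb c hc h v (List.mem_of_getElem? hk) (List.mem_of_getElem? hm)
    refine ⟨rfl, ?_⟩
    obtain ⟨hlt, -⟩ := List.getElem?_eq_some_iff.1 hk
    exact (List.getElem?_inj hlt (hf b hb).2.1).1 (hk.trans hm.symm)
  have hSE : ∀ {x y}, S x y → E x y := by
    rintro x y ⟨b, hb, k, hk, hk'⟩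
    obtain ⟨h, rfl⟩ := List.getElem?_eq_some_iff.1 hk
    obtain ⟨h', rfl⟩ := List.getElem?_eq_some_iff.1 hk'
    exact List.isChain_iff_getElem.1 (hf b hb).1 k h'
  have hleft : ∀ {x x' y}, S x y → S x' y → x = x' := by
    rintro x x' y ⟨b, hb, k, hk, hk'⟩ ⟨c, hc, m, hm, hm'⟩
    obtain ⟨rfl, h⟩ := hpos hb hc hk' hm'
    obtain rfl : k = m := by omega
    exact Option.some.inj (hk.symm.trans hm)
  have hright : ∀ {x y y'}, S x y → S x y' → y = y' := by
    rintro x y y' ⟨b, hb, k, hk, hk'⟩ ⟨c, hc, m, hm, hm'⟩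
    obtain ⟨rfl, rfl⟩ := hpos hb hc hk hm
    exact Option.some.inj (hk'.symm.trans hm')
  have hsucc : ∀ i : {v : V // v ∉ B}, ∃ u, S i.1 u ∨ (u = i.1 ∧ ∀ b ∈ B, i.1 ∉ f b) := by
    intro i
    by_cases h : ∀ b ∈ B, i.1 ∉ f b
    · exact ⟨i.1, Or.inr ⟨rfl, h⟩⟩
    · push Not at h
      obtain ⟨b, hb, hi⟩ := h
      obtain ⟨k, hk⟩ := List.mem_iff_getElem?.1 hi
      have hlt := (List.getElem?_eq_some_iff.1 hk).1
      by_cases hk' : k + 1 < (f b).length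
      · exact ⟨(f b)[k + 1], Or.inl ⟨b, hb, k, hk, List.getElem?_eq_getElem hk'⟩⟩
      · have hl := (hf b hb).2.2
        rw [List.getLast?_eq_getElem?, show (f b).length - 1 = k by omega, hk] at hl
        exact absurd (Option.some.inj hl ▸ hb) i.2
  choose a ha using hsucc
  refine ⟨a, ⟨fun i j hij => ?_, fun i => (hA i _).2 ?_⟩, ?_⟩
  · rcases ha i with hi | ⟨hi, hi'⟩ <;> rcases ha j with hj | ⟨hj, hj'⟩
    · exact Subtype.ext (hleft hi (hij ▸ hj))
    · obtain ⟨b, hb, k, -, hk⟩ := hi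
      rw [hij, hj] at hk
      exact absurd (List.mem_of_getElem? hk) (hj' b hb)
    · obtain ⟨b, hb, k, -, hk⟩ := hj
      rw [← hij, hi] at hk
      exact absurd (List.mem_of_getElem? hk) (hi' b hb)
    · exact Subtype.ext (hi.symm.trans (hij.trans hj))
  · exact (ha i).elim (fun h => Or.inr (hSE h)) fun h => Or.inl h.1
  · ext x
    have hx := hhead x
    rw [Finset.mem_compl] at hx
    rw [← not_iff_not, hx]
    simp only [Finset.mem_image, Finset.mem_univ, true_and, not_exists, List.head?_eq_getElem?]
    constructor
    · rintro ⟨b, hb, h0⟩ i rfl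
      rcases ha i with ⟨c, hc, k, -, hk⟩ | ⟨hi, hi'⟩
      · have := (hpos hb hc h0 hk).2
        omega
      · rw [hi] at h0
        exact hi' b hb (List.mem_of_getElem? h0)
    · intro h
      by_cases hp : ∀ b ∈ B, x ∉ f b
      · have hxB : x ∉ B := fun hb => hp x hb (List.mem_of_getLast? (hf x hb).2.2)
        rcases ha ⟨x, hxB⟩ with ⟨b, hb, k, hk, -⟩ | ⟨hi, -⟩
        · exact absurd (List.mem_of_getElem? hk) (hp b hb)
        · exact absurd hi (h _)
      · push Not at hp
        obtain ⟨b, hb, hxb⟩ := hp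
        obtain ⟨k, hk⟩ := List.mem_iff_getElem?.1 hxb
        cases k with
        | zero => exact ⟨b, hb, hk⟩
        | succ k =>
          have hlt := (List.getElem?_eq_some_iff.1 hk).1
          have hS : S (f b)[k] x := ⟨b, hb, k, List.getElem?_eq_getElem (by omega), hk⟩
          have hB : (f b)[k] ∉ B := fun hB => hPl.2 _ hB _ (hSE hS)
          rcases ha ⟨_, hB⟩ with hi | ⟨-, hi⟩
          · exact absurd (hright hi hS) (h _)
          · exact absurd (List.getElem_mem _) (hi b hb)

/-- Let `(G,B)` be a planted graph on `V` and, for each `i ∈ V − B`, let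
`A_i = {i} ∪ {u : e_{iu} ∈ G}`.  Then `i ↦ i` is an SDR of the family
`𝒜 = (A_i)_{i ∈ V − B}`, and a set `T ⊆ V` is a transversal of `𝒜` if and only
if its complement `V − T` is routable to `B` in `(G,B)`; in particular the
transversal matroid of `𝒜` is the dual of the cotransversal matroid `L(G,B)`. -/
theorem planted_to_transversal_duality {V : Type*} [DecidableEq V] [Fintype V]
    (E : V → V → Prop) (B : Finset V) (hPl : IsPlanted E B)
    (A : {v : V // v ∉ B} → Finset V)
    (hA : ∀ i : {v : V // v ∉ B}, ∀ u : V, u ∈ A i ↔ (u = i.1 ∨ E i.1 u)) :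
    IsSDR A (fun i => i.1) ∧
    ∀ T : Finset V, (IsTransversal A T ↔ Routable E B Tᶜ) := by
  refine ⟨⟨Subtype.val_injective, fun i => (hA i _).2 (Or.inl rfl)⟩,
    fun T => ⟨fun h => ?_, fun h => ?_⟩⟩
  · exact h.routable_compl hPl hA
  · exact h.isTransversal_of_compl hPl hA
end

section
/- Let 𝒜 = (A_1, …, A_k) be a family of subsets of a finite set V and let (a_1, …, a_k) be an SDR of 𝒜. Construct the directed graph G on vertex set V with an edge from a_j to x for every j and every x ∈ A_j with x ≠ a_j, and let B := V − {a_1, …, a_k}. Assume every vertex of B is a sink of G (so (G,B) is a planted graph). Then a set A ⊆ V is routable to B in (G,B) if and only if V − A is a transversal of 𝒜; that is, (G,B) is a presentation of the dual of the transversal matroid of 𝒜. -/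
/-- Two orbit points of vertices of `B` under a permutation `π` whose inverse image of `B` is
contained in `S` cannot coincide unless one of the orbits has met `S` before. -/
theorem iterate_eq_of_avoids {V : Type*} (π : Equiv.Perm V) {B S : Finset V}
    (hπ : ∀ x, π x ∈ B → x ∈ S) {b c : V} (hb : b ∈ B) {i j : ℕ} (hij : i ≤ j)
    (hc : ∀ m < j, π^[m] c ∉ S) (h : π^[i] b = π^[j] c) : b = c ∧ i = j := by
  obtain ⟨d, rfl⟩ := Nat.exists_eq_add_of_le hij
  rw [Function.iterate_add_apply] at h
  have hbc : b = π^[d] c := π.injective.iterate i h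
  cases d with
  | zero => exact ⟨hbc, rfl⟩
  | succ d =>
    rw [Function.iterate_succ_apply'] at hbc
    exact absurd (hπ _ (hbc ▸ hb)) (hc d (by omega))

/-- The orbit segments of the vertices of `B`, read backwards from their first point in `S`,
form a routing from `S` to `B`. -/
theorem routable_of_perm {V : Type*} [Finite V] (π : Equiv.Perm V) {E : V → V → Prop}
    {B S : Finset V} (hπ : ∀ x, π x ∈ B → x ∈ S) (hcard : S.card ≤ B.card)
    (hE : ∀ x, x ∉ S → π x ≠ x → E (π x) x) : Routable E B S := by
  classical
  have hex : ∀ b ∈ B, ∃ n, π^[n] b ∈ S := by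
    intro b hb
    obtain ⟨n, hn, hp⟩ := isOfFinOrder_iff_pow_eq_one.1 (isOfFinOrder_of_finite π)
    obtain ⟨m, rfl⟩ := Nat.exists_eq_succ_of_ne_zero hn.ne'
    refine ⟨m, hπ _ ?_⟩
    rwa [← Function.iterate_succ_apply' π, ← Equiv.Perm.coe_pow, hp, Equiv.Perm.one_apply]
  have hmin : ∀ b, ∃ n, b ∈ B → π^[n] b ∈ S ∧ ∀ m < n, π^[m] b ∉ S := by
    intro b
    by_cases hb : b ∈ B
    · exact ⟨Nat.find (hex b hb), fun _ => ⟨Nat.find_spec (hex b hb), fun m => Nat.find_min _⟩⟩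
    · exact ⟨0, fun h => absurd h hb⟩
  choose n hn using hmin
  have key : ∀ b ∈ B, ∀ c ∈ B, ∀ i ≤ n b, ∀ j ≤ n c, π^[i] b = π^[j] c → b = c ∧ i = j := by
    intro b hb c hc i hi j hj h
    rcases le_total i j with hij | hij
    · exact iterate_eq_of_avoids π hπ hb hij (fun m hm => (hn c hc).2 m (hm.trans_le hj)) h
    · have := iterate_eq_of_avoids π hπ hc hij (fun m hm => (hn b hb).2 m (hm.trans_le hi)) h.symm
      exact ⟨this.1.symm, this.2.symm⟩
  have hinj : Set.InjOn (fun b => π^[n b] b) B := fun b hb c hc h =>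
    (key b hb c hc _ le_rfl _ le_rfl h).1
  have hsurj := Finset.surjOn_of_injOn_of_card_le (fun b => π^[n b] b)
    (fun b hb => (hn b hb).1) hinj hcard
  refine ⟨fun b => List.ofFn fun i : Fin (n b + 1) => π^[n b - i] b, ?_, ?_, ?_⟩
  · intro b hb
    refine ⟨?_, ?_, ?_⟩
    · refine List.isChain_iff_getElem.2 fun i hi => ?_
      rw [List.length_ofFn] at hi
      simp only [List.getElem_ofFn]
      obtain ⟨m, hm⟩ : ∃ m, n b - i = m + 1 := ⟨n b - i - 1, by omega⟩
      have hm' : n b - (i + 1) = m := by omega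
      rw [hm, hm', Function.iterate_succ_apply']
      refine hE _ ((hn b hb).2 m (by omega)) fun h => ?_
      rw [← Function.iterate_succ_apply' π] at h
      have := (key b hb b hb _ (by omega) _ (by omega) h).2
      omega
    · refine List.nodup_ofFn.2 fun i j h => Fin.ext ?_
      have := (key b hb b hb _ (Nat.sub_le _ _) _ (Nat.sub_le _ _) h).2
      omega
    · rw [List.getLast?_eq_getElem?, List.length_ofFn, Nat.add_sub_cancel,
        List.getElem?_eq_getElem (by simp), List.getElem_ofFn]
      simp
  · intro b hb c hc hbc v hv hv'
    obtain ⟨i, rfl⟩ := (List.mem_ofFn' _ _).1 hv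
    obtain ⟨j, hj⟩ := (List.mem_ofFn' _ _).1 hv'
    exact hbc (key b hb c hc _ (Nat.sub_le _ _) _ (Nat.sub_le _ _) hj.symm).1
  · intro s
    simp only [List.ofFn_succ, List.head?_cons, Option.some.injEq, Fin.val_zero, Nat.sub_zero]
    exact ⟨fun hs => hsurj hs, fun ⟨b, hb, h⟩ => h ▸ (hn b hb).1⟩


/-- Let `𝒜 = (A_1, …, A_k)` be a family of subsets of a finite set `V` with an SDR
`(a_1, …, a_k)`.  Build the directed graph `G` with an edge from `a_j` to `x` for
every `j` and every `x ∈ A_j` with `x ≠ a_j`, and let `B = V − {a_1, …, a_k}`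
(every vertex of `B` is then a sink, so `(G,B)` is a planted graph).  Then a set
`A ⊆ V` is routable to `B` in `(G,B)` if and only if `V − A` is a transversal of
`𝒜`; that is, `(G,B)` is a presentation of the dual of the transversal matroid
of `𝒜`. -/
theorem transversal_to_planted_duality {V : Type*} [DecidableEq V] [Fintype V]
    {k : ℕ} (A : Fin k → Finset V) (a : Fin k → V) (ha : IsSDR A a)
    (E : V → V → Prop)
    (hE : ∀ x y : V, E x y ↔ ∃ j : Fin k, a j = x ∧ y ∈ A j ∧ y ≠ x)
    (B : Finset V) (hB : B = Finset.univ \ Finset.image a Finset.univ)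
    (hSink : ∀ b ∈ B, ∀ v, ¬ E b v)
    (S : Finset V) :
    Routable E B S ↔ IsTransversal A Sᶜ := by
  have memB : ∀ x, x ∈ B ↔ ∀ j, a j ≠ x := by simp [hB]
  constructor
  · rintro ⟨f, hf, hdisj, hhead⟩
    have key : ∀ b ∈ B, ∀ c ∈ B, ∀ (i j : ℕ) (x : V), (f b)[i]? = some x → (f c)[j]? = some x →
        b = c ∧ i = j := by
      intro b hb c hc i j x hi hj
      have hbc : b = c := by
        by_contra hbc
        exact hdisj b hb c hc hbc x (List.mem_of_getElem? hi) (List.mem_of_getElem? hj)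
      subst hbc
      obtain ⟨hi', hi⟩ := List.getElem?_eq_some_iff.1 hi
      obtain ⟨hj', hj⟩ := List.getElem?_eq_some_iff.1 hj
      exact ⟨rfl, (hf b hb).2.1.getElem_inj_iff.1 (hi.trans hj.symm)⟩
    have hnext : ∀ j, ∃ y,
        (∃ b ∈ B, ∃ i, (f b)[i]? = some (a j) ∧ (f b)[i + 1]? = some y) ∨
          ((∀ b ∈ B, a j ∉ f b) ∧ y = a j) := by
      intro j
      by_cases h : ∀ b ∈ B, a j ∉ f b
      · exact ⟨a j, Or.inr ⟨h, rfl⟩⟩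
      · push Not at h
        obtain ⟨b, hb, hj⟩ := h
        obtain ⟨i, hi⟩ := List.mem_iff_getElem?.1 hj
        obtain ⟨hi', hi₀⟩ := List.getElem?_eq_some_iff.1 hi
        have hlast := (hf b hb).2.2
        rw [List.getLast?_eq_getElem?] at hlast
        have hlt : i + 1 < (f b).length := by
          by_contra hlt
          have hi_last : i = (f b).length - 1 := by omega
          rw [← hi_last, hi, Option.some.injEq] at hlast
          exact (memB b).1 hb j hlast
        exact ⟨(f b)[i + 1], Or.inl ⟨b, hb, i, hi, List.getElem?_eq_getElem hlt⟩⟩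
    choose g hg using hnext
    refine ⟨g, ⟨fun j l hjl => ?_, fun j => ?_⟩, ?_⟩
    · rcases hg j with ⟨b, hb, i, hi, hi'⟩ | ⟨hj, hj'⟩ <;>
        rcases hg l with ⟨c, hc, m, hm, hm'⟩ | ⟨hl, hl'⟩
      · obtain ⟨rfl, him⟩ := key b hb c hc _ _ _ hi' (hjl ▸ hm')
        obtain rfl : i = m := by omega
        exact ha.1 (Option.some.inj (hi.symm.trans hm))
      · exact absurd (List.mem_of_getElem? (hjl.trans hl' ▸ hi')) (hl b hb)
      · exact absurd (List.mem_of_getElem? (hjl.symm.trans hj' ▸ hm')) (hj c hc)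
      · exact ha.1 (hj'.symm.trans (hjl.trans hl'))
    · rcases hg j with ⟨b, hb, i, hi, hi'⟩ | ⟨-, hj⟩
      · obtain ⟨hlt, hi⟩ := List.getElem?_eq_some_iff.1 hi
        obtain ⟨hlt', hi'⟩ := List.getElem?_eq_some_iff.1 hi'
        have hedge := List.isChain_iff_getElem.1 (hf b hb).1 i hlt'
        rw [hi, hi', hE] at hedge
        obtain ⟨l, hl, hmem, -⟩ := hedge
        exact ha.1 hl ▸ hmem
      · exact hj ▸ ha.2 j
    · ext x
      simp only [Finset.mem_compl, Finset.mem_image, Finset.mem_univ, true_and]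
      constructor
      · intro hx
        by_cases hon : ∃ b ∈ B, x ∈ f b
        · obtain ⟨b, hb, hxb⟩ := hon
          obtain ⟨i, hi⟩ := List.mem_iff_getElem?.1 hxb
          cases i with
          | zero => exact absurd ((hhead x).2 ⟨b, hb, by rw [List.head?_eq_getElem?, hi]⟩) hx
          | succ i =>
            obtain ⟨hlt, hi₀⟩ := List.getElem?_eq_some_iff.1 hi
            have hedge := List.isChain_iff_getElem.1 (hf b hb).1 i hlt
            obtain ⟨j, hj, -⟩ := (hE _ _).1 hedge
            have hij : (f b)[i]? = some (a j) := by
              rw [hj]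
              exact List.getElem?_eq_getElem _
            refine ⟨j, ?_⟩
            rcases hg j with ⟨c, hc, m, hm, hm'⟩ | ⟨hoff, -⟩
            · obtain ⟨rfl, rfl⟩ := key b hb c hc _ _ _ hij hm
              exact Option.some.inj (hm'.symm.trans hi)
            · exact absurd (List.mem_of_getElem? hij) (hoff b hb)
        · have hxB : x ∉ B := fun hxB =>
            hon ⟨x, hxB, List.mem_of_getLast? (hf x hxB).2.2⟩
          rw [memB] at hxB
          push Not at hxB
          obtain ⟨j, rfl⟩ := hxB
          refine ⟨j, ?_⟩
          rcases hg j with ⟨c, hc, m, hm, -⟩ | ⟨-, hj⟩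
          · exact absurd ⟨c, hc, List.mem_of_getElem? hm⟩ hon
          · exact hj
      · rintro ⟨j, rfl⟩ hS
        obtain ⟨b, hb, h⟩ := (hhead _).1 hS
        rw [List.head?_eq_getElem?] at h
        rcases hg j with ⟨c, hc, m, -, hm⟩ | ⟨hoff, hj⟩
        · have := (key b hb c hc _ _ _ h hm).2
          omega
        · exact hoff b hb (hj ▸ List.mem_of_getElem? h)
  · rintro ⟨g, ⟨hginj, hgA⟩, hS⟩
    have memS : ∀ x, x ∉ S ↔ ∃ j, g j = x := fun x => by
      rw [← Finset.mem_compl, hS]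
      simp
    let e : {x // x ∈ Set.range g} ≃ {x // x ∈ Set.range a} :=
      (Equiv.ofInjective g hginj).symm.trans (Equiv.ofInjective a ha.1)
    have hπ : ∀ j, e.extendSubtype (g j) = a j := fun j => by
      rw [Equiv.extendSubtype_apply_of_mem _ _ ⟨j, rfl⟩]
      simp [e, Equiv.ofInjective_symm_apply]
    refine routable_of_perm e.extendSubtype (fun x hx => ?_) ?_ fun x hx hne => ?_
    · by_contra hxS
      obtain ⟨j, rfl⟩ := (memS x).1 hxS
      exact (memB _).1 hx j (hπ j).symm
    · have hcS : Sᶜ.card = k := by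
        rw [hS, Finset.card_image_of_injective _ hginj, Finset.card_fin]
      have hcB : Bᶜ.card = k := by
        rw [hB, ← Finset.compl_eq_univ_sdiff, compl_compl,
          Finset.card_image_of_injective _ ha.1, Finset.card_fin]
      have h₁ := Finset.card_add_card_compl S
      have h₂ := Finset.card_add_card_compl B
      omega
    · obtain ⟨j, rfl⟩ := (memS x).1 hx
      rw [hπ] at hne ⊢
      exact (hE _ _).2 ⟨j, rfl, hgA j, hne.symm⟩
end

section
/- For any planted graph (G,B) on vertex set V there exists a unique maximal planted graph (G̅,B) containing (G,B): G ⊆ G̅, every vertex of B is a sink of G̅, the routable sets of (G̅,B) equal the routable sets of (G,B), and any planted graph (H,B) with G̅ ⊆ H whose routable sets equal those of (G,B) satisfies H = G̅. The planted graph (G̅,B) is called the saturation of (G,B). -/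
/-- A set `I` of vertices is matchable into the complement of `B` if each `i ∈ I` can be assigned
injectively a vertex outside `B` that is equal to `i` or is an in-neighbour of `i`. -/
def Matchable {V : Type*} (E : V → V → Prop) (B I : Finset V) : Prop :=
  ∃ g : V → V, Set.InjOn g I ∧ ∀ i ∈ I, g i ∉ B ∧ (g i = i ∨ E (g i) i)

/-- The graph obtained from `E` by adding the edge from `x` to `y`. -/
def addEdge {V : Type*} (E : V → V → Prop) (x y : V) : V → V → Prop :=
  fun u v => E u v ∨ (u = x ∧ v = y)

/-- The vertices reached by alternating paths of the matching `g` of `I` starting in `I \ C`. -/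
inductive AlternatingReach {V : Type*} (g : V → V) (I C : Finset V) : V → Prop
  | start {i : V} : i ∈ I → i ∉ C → AlternatingReach g I C (g i)
  | step {i : V} : i ∈ I → AlternatingReach g I C i → AlternatingReach g I C (g i)

section

variable {V : Type*} {E E' : V → V → Prop} {B I J : Finset V}

theorem Matchable.mono_edges (h : Matchable E B I) (hE : ∀ x y, E x y → E' x y) :
    Matchable E' B I := by
  obtain ⟨g, hg, hI⟩ := h
  exact ⟨g, hg, fun i hi => ⟨(hI i hi).1, (hI i hi).2.imp_right (hE _ _)⟩⟩

theorem Matchable.subset (h : Matchable E B I) (hJ : J ⊆ I) : Matchable E B J := by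
  obtain ⟨g, hg, hI⟩ := h
  exact ⟨g, hg.mono (by exact_mod_cast hJ), fun i hi => hI i (hJ hi)⟩

theorem IsPlanted.addEdge (h : IsPlanted E B) {x y : V} (hx : x ∉ B) (hxy : x ≠ y) :
    IsPlanted (addEdge E x y) B := by
  refine ⟨?_, ?_⟩
  · rintro v (hv | ⟨rfl, rfl⟩)
    · exact h.1 v hv
    · exact hxy rfl
  · rintro b hb v (hv | ⟨rfl, rfl⟩)
    · exact h.2 b hb v hv
    · exact hx hb

theorem iterate_injOn_compl {A : Finset V} {g : V → V}
    (hg : ∀ u v, u ∉ A → v ∉ A → g u = g v → u = v) (hgB : ∀ v, v ∉ A → g v ∉ B) {b c : V}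
    (hb : b ∈ B) (hc : c ∈ B) {i j : ℕ} (hi : ∀ k < i, g^[k] b ∉ A) (hj : ∀ k < j, g^[k] c ∉ A)
    (h : g^[i] b = g^[j] c) : b = c ∧ i = j := by
  induction i generalizing j with
  | zero =>
    cases j with
    | zero => exact ⟨h, rfl⟩
    | succ j =>
      rw [Function.iterate_succ_apply'] at h
      exact absurd (h ▸ hb) (hgB _ (hj j j.lt_succ_self))
  | succ i ih =>
    cases j with
    | zero =>
      rw [Function.iterate_succ_apply'] at h
      exact absurd (show g _ ∈ B from h ▸ hc) (hgB _ (hi i i.lt_succ_self))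
    | succ j =>
      rw [Function.iterate_succ_apply', Function.iterate_succ_apply'] at h
      have := ih (j := j) (fun k hk => hi k (by omega)) (fun k hk => hj k (by omega))
        (hg _ _ (hi i i.lt_succ_self) (hj j j.lt_succ_self) h)
      exact ⟨this.1, by rw [this.2]⟩

variable [DecidableEq V]

/-- A matching of `I` into `C` extends to a perfect matching of `C`. -/
theorem exists_perfect_matching_extension {g : V → V} {C : Finset V} (hg : Set.InjOn g I)
    (hI : ∀ i ∈ I, g i ∈ C ∧ (g i = i ∨ E (g i) i)) :
    ∃ K, I ⊆ K ∧ K.card = C.card ∧ ∃ g' : V → V, Set.InjOn g' K ∧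
      ∀ k ∈ K, g' k ∈ C ∧ (g' k = k ∨ E (g' k) k) := by
  classical
  let R := AlternatingReach g I C
  let K := I.filter (fun k => k ∉ C ∨ R k) ∪ C.filter (fun k => ¬ R k)
  let g' : V → V := fun k => if k ∈ C ∧ ¬ R k then k else g k
  have hK : ∀ k, k ∈ K ↔ (k ∈ I ∧ (k ∉ C ∨ R k)) ∨ (k ∈ C ∧ ¬ R k) := by
    intro k; simp [K]
  have hR : ∀ k, k ∈ I → (k ∉ C ∨ R k) → R (g k) := by
    rintro k hk (h | h)
    · exact .start hk h
    · exact .step hk h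
  have hg₁ : ∀ k, (k ∉ C ∨ R k) → g' k = g k := by
    intro k hk; exact if_neg (by tauto)
  have hg₂ : ∀ k, k ∈ C ∧ ¬ R k → g' k = k := fun k hk => if_pos hk
  have hinj : Set.InjOn g' K := by
    intro a ha b hb hab
    rw [Finset.mem_coe, hK] at ha hb
    rcases ha with ⟨ha, ha'⟩ | ha <;> rcases hb with ⟨hb, hb'⟩ | hb
    · rw [hg₁ a ha', hg₁ b hb'] at hab
      exact hg ha hb hab
    · rw [hg₁ a ha', hg₂ b hb] at hab
      exact absurd (hab ▸ hR a ha ha') hb.2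
    · rw [hg₂ a ha, hg₁ b hb'] at hab
      exact absurd (hab ▸ hR b hb hb') ha.2
    · rwa [hg₂ a ha, hg₂ b hb] at hab
  have hmem : ∀ k ∈ K, g' k ∈ C ∧ (g' k = k ∨ E (g' k) k) := by
    intro k hk
    rcases (hK k).1 hk with ⟨h, h'⟩ | h
    · rw [hg₁ k h']; exact hI k h
    · rw [hg₂ k h]; exact ⟨h.1, Or.inl rfl⟩
  refine ⟨K, ?_, ?_, g', hinj, hmem⟩
  · intro i hi
    rw [hK]; tauto
  · rw [← Finset.card_image_of_injOn hinj]
    congr 1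
    ext c
    rw [Finset.mem_image]
    constructor
    · rintro ⟨k, hk, rfl⟩
      exact (hmem k hk).1
    · intro hc
      by_cases h : R c
      · cases h with
        | start hi hiC => exact ⟨_, (hK _).2 (.inl ⟨hi, .inl hiC⟩), hg₁ _ (.inl hiC)⟩
        | step hi hiR => exact ⟨_, (hK _).2 (.inl ⟨hi, .inr hiR⟩), hg₁ _ (.inr hiR)⟩
      · exact ⟨c, (hK c).2 (.inr ⟨hc, h⟩), hg₂ c ⟨hc, h⟩⟩

theorem Routable.card_eq {A : Finset V} (h : Routable E B A) : A.card = B.card := by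
  obtain ⟨f, hf, hdisj, hA⟩ := h
  have hne : ∀ b ∈ B, ∃ a, (f b).head? = some a := by
    intro b hb
    cases hl : f b with
    | nil => simpa [hl] using (hf b hb).2.2
    | cons a l => exact ⟨a, rfl⟩
  choose! s hs using hne
  have himg : B.image s = A := by
    ext a
    rw [hA, Finset.mem_image]
    refine exists_congr fun b => and_congr_right fun hb => ?_
    rw [hs b hb, Option.some_inj]
  rw [← himg, Finset.card_image_of_injOn]
  intro b hb c hc h
  by_contra hbc
  refine hdisj b hb c hc hbc (s b) (List.mem_of_head? (hs b hb)) ?_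
  rw [h]
  exact List.mem_of_head? (hs c hc)

variable [Fintype V]

theorem Matchable.routable {A : Finset V} (h : Matchable E B Aᶜ) (hcard : A.card = B.card) :
    Routable E B A := by
  obtain ⟨g, hg, hA⟩ := h
  have hinj : ∀ u v, u ∉ A → v ∉ A → g u = g v → u = v := fun u v hu hv =>
    hg (by simpa using hu) (by simpa using hv)
  have hgB : ∀ v, v ∉ A → g v ∉ B := fun v hv => (hA v (by simpa using hv)).1
  have hgE : ∀ v, v ∉ A → g v = v ∨ E (g v) v := fun v hv => (hA v (by simpa using hv)).2
  have hex : ∀ b ∈ B, ∃ n, g^[n] b ∈ A := by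
    intro b hb
    by_contra! hn
    obtain ⟨i, j, hij, h⟩ := Finite.exists_ne_map_eq_of_infinite (fun n => g^[n] b)
    exact hij (iterate_injOn_compl hinj hgB hb hb (fun k _ => hn k) (fun k _ => hn k) h).2
  have hT : ∃ T : V → ℕ, ∀ b ∈ B, g^[T b] b ∈ A ∧ ∀ k < T b, g^[k] b ∉ A := by
    classical
    refine ⟨fun b => if hb : b ∈ B then Nat.find (hex b hb) else 0, fun b hb => ?_⟩
    simp only [hb, dif_pos]
    exact ⟨Nat.find_spec (hex b hb), fun k hk => Nat.find_min (hex b hb) hk⟩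
  obtain ⟨T, hT⟩ := hT
  have key : ∀ b ∈ B, ∀ c ∈ B, ∀ i ≤ T b, ∀ j ≤ T c, g^[i] b = g^[j] c → b = c ∧ i = j :=
    fun b hb c hc i hi j hj h => iterate_injOn_compl hinj hgB hb hc
      (fun k hk => (hT b hb).2 k (by omega)) (fun k hk => (hT c hc).2 k (by omega)) h
  have himg : B.image (fun b => g^[T b] b) = A := by
    refine Finset.eq_of_subset_of_card_le ?_ ?_
    · intro a ha
      obtain ⟨b, hb, rfl⟩ := Finset.mem_image.1 ha
      exact (hT b hb).1
    · rw [Finset.card_image_of_injOn, hcard]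
      intro b hb c hc h
      exact (key b hb c hc _ le_rfl _ le_rfl h).1
  refine ⟨fun b => ((List.range (T b + 1)).map (fun n => g^[n] b)).reverse, ?_, ?_, ?_⟩
  · intro b hb
    refine ⟨?_, ?_, ?_⟩
    · show List.IsChain E _
      rw [List.isChain_reverse, List.isChain_iff_getElem]
      intro i hi
      simp only [List.length_map, List.length_range] at hi
      simp only [List.getElem_map, List.getElem_range, Function.iterate_succ_apply']
      refine (hgE _ ((hT b hb).2 i (by omega))).resolve_left fun h => ?_
      rw [← Function.iterate_succ_apply' (f := g)] at h
      have := (key b hb b hb _ (by omega) _ (by omega) h).2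
      omega
    · rw [List.nodup_reverse]
      refine List.Nodup.map_on ?_ List.nodup_range
      intro i hi j hj h
      rw [List.mem_range] at hi hj
      exact (key b hb b hb i (by omega) j (by omega) h).2
    · simp [List.getLast?_reverse, List.range_succ_eq_map]
  · intro b hb c hc hbc v hvb hvc
    simp only [List.mem_reverse, List.mem_map, List.mem_range] at hvb hvc
    obtain ⟨i, hi, rfl⟩ := hvb
    obtain ⟨j, hj, h⟩ := hvc
    exact hbc (key b hb c hc i (by omega) j (by omega) h.symm).1
  · intro a
    rw [← himg, Finset.mem_image]
    simp [List.range_succ]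

theorem Routable.matchable_compl {A : Finset V} (hPl : IsPlanted E B) (h : Routable E B A) :
    Matchable E B Aᶜ := by
  classical
  obtain ⟨f, hf, hdisj, hA⟩ := h
  let S : V → V → Prop := fun u v =>
    ∃ b ∈ B, ∃ i : ℕ, (f b)[i]? = some u ∧ (f b)[i + 1]? = some v
  have hSE : ∀ u v, S u v → E u v := by
    rintro u v ⟨b, hb, i, hu, hv⟩
    obtain ⟨hi, rfl⟩ := List.getElem?_eq_some_iff.1 hu
    obtain ⟨hi', rfl⟩ := List.getElem?_eq_some_iff.1 hv
    exact List.isChain_iff_getElem.1 (hf b hb).1 i hi'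
  have hSfun : ∀ u v w, S u v → S u w → v = w := by
    rintro u v w ⟨b, hb, i, hu, hv⟩ ⟨c, hc, j, hu', hw⟩
    have hbc : b = c := by
      by_contra hbc
      exact hdisj b hb c hc hbc u (List.mem_of_getElem? hu) (List.mem_of_getElem? hu')
    subst hbc
    have hij : i = j := by
      refine (List.getElem?_inj ?_ (hf b hb).2.1).1 (hu.trans hu'.symm)
      exact (List.getElem?_eq_some_iff.1 hu).1
    subst hij
    exact Option.some_inj.1 (hv.symm.trans hw)
  have hpath : ∀ v ∉ A, ∀ b ∈ B, v ∈ f b → ∃ u, S u v := by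
    intro v hv b hb hvb
    obtain ⟨i, hi⟩ := List.getElem?_of_mem hvb
    cases i with
    | zero => exact absurd ((hA v).2 ⟨b, hb, by rwa [List.head?_eq_getElem?]⟩) hv
    | succ i =>
      have hlt := (List.getElem?_eq_some_iff.1 hi).1
      exact ⟨(f b)[i], b, hb, i, List.getElem?_eq_getElem _, hi⟩
  let g : V → V := fun v => if h : ∃ u, S u v then h.choose else v
  have hg₁ : ∀ v, (∃ u, S u v) → S (g v) v := by
    intro v hv
    simp only [g, dif_pos hv]
    exact hv.choose_spec
  have hg₂ : ∀ v, (¬ ∃ u, S u v) → g v = v := fun v hv => dif_neg hv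
  have hSpath : ∀ u v, S u v → ∃ b ∈ B, u ∈ f b := by
    rintro u v ⟨b, hb, i, hu, -⟩
    exact ⟨b, hb, List.mem_of_getElem? hu⟩
  refine ⟨g, ?_, ?_⟩
  · intro v hv w hw hvw
    have hv' : v ∉ A := by simpa using hv
    have hw' : w ∉ A := by simpa using hw
    by_cases h₁ : ∃ u, S u v <;> by_cases h₂ : ∃ u, S u w
    · exact hSfun _ _ _ (hg₁ v h₁) (hvw ▸ hg₁ w h₂)
    · obtain ⟨b, hb, hm⟩ := hSpath _ _ (hg₁ v h₁)
      rw [hvw, hg₂ w h₂] at hm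
      exact absurd (hpath w hw' b hb hm) h₂
    · obtain ⟨b, hb, hm⟩ := hSpath _ _ (hg₁ w h₂)
      rw [← hvw, hg₂ v h₁] at hm
      exact absurd (hpath v hv' b hb hm) h₁
    · rwa [hg₂ v h₁, hg₂ w h₂] at hvw
  · intro v hv
    have hv' : v ∉ A := by simpa using hv
    by_cases h : ∃ u, S u v
    · have hE := hSE _ _ (hg₁ v h)
      exact ⟨fun hB => hPl.2 _ hB _ hE, .inr hE⟩
    · rw [hg₂ v h]
      exact ⟨fun hB => h (hpath v hv' v hB (List.mem_of_getLast? (hf v hB).2.2)), .inl rfl⟩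

/-- The routable sets are the complements of the bases of a transversal matroid. -/
theorem routable_iff_matchable_compl {A : Finset V} (hPl : IsPlanted E B) :
    Routable E B A ↔ A.card = B.card ∧ Matchable E B Aᶜ :=
  ⟨fun h => ⟨h.card_eq, h.matchable_compl hPl⟩, fun h => h.2.routable h.1⟩

theorem matchable_iff_exists_routable (hPl : IsPlanted E B) :
    Matchable E B I ↔ ∃ A, Routable E B A ∧ I ⊆ Aᶜ := by
  constructor
  · rintro ⟨g, hg, hI⟩
    obtain ⟨K, hIK, hcard, g', hg', hK⟩ := exists_perfect_matching_extension (C := Bᶜ) hg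
      (fun i hi => ⟨Finset.mem_compl.2 (hI i hi).1, (hI i hi).2⟩)
    refine ⟨Kᶜ, (routable_iff_matchable_compl hPl).2 ⟨?_, ?_⟩, by rwa [compl_compl]⟩
    · rw [Finset.card_compl, hcard, ← Finset.card_compl, compl_compl]
    · rw [compl_compl]
      exact ⟨g', hg', fun k hk => ⟨Finset.mem_compl.1 (hK k hk).1, (hK k hk).2⟩⟩
  · rintro ⟨A, hA, hIA⟩
    exact (hA.matchable_compl hPl).subset hIA

theorem forall_routable_iff_forall_matchable (hE : IsPlanted E B) (hE' : IsPlanted E' B) :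
    (∀ A, Routable E B A ↔ Routable E' B A) ↔ ∀ I, Matchable E B I ↔ Matchable E' B I := by
  constructor
  · intro h I
    simp only [matchable_iff_exists_routable hE, matchable_iff_exists_routable hE', h]
  · intro h A
    rw [routable_iff_matchable_compl hE, routable_iff_matchable_compl hE', h]

open Classical in
/-- Hall's theorem: a set that is not matchable has a subset with too few neighbours. -/
theorem exists_hall_violator (h : ¬ Matchable E B I) :
    ∃ T ⊆ I, (Finset.univ.filter (fun c => c ∉ B ∧ ∃ t ∈ T, c = t ∨ E c t)).card < T.card := by
  by_contra! hT
  apply h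
  let t : I → Finset V := fun i => Finset.univ.filter (fun c => c ∉ B ∧ (c = i ∨ E c i))
  have hall : ∀ s : Finset I, s.card ≤ (s.biUnion t).card := by
    intro s
    have hs := hT (s.map (Function.Embedding.subtype _)) (by
      intro i hi
      simp only [Finset.mem_map, Function.Embedding.subtype_apply] at hi
      obtain ⟨j, -, rfl⟩ := hi
      exact j.2)
    rw [Finset.card_map] at hs
    refine hs.trans (Finset.card_le_card ?_)
    intro c hc
    simp only [Finset.mem_filter, Finset.mem_univ, true_and, Finset.mem_map,
      Function.Embedding.subtype_apply] at hc
    obtain ⟨hcB, _, ⟨j, hj, rfl⟩, hcj⟩ := hc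
    simp only [Finset.mem_biUnion, t, Finset.mem_filter, Finset.mem_univ, true_and]
    exact ⟨j, hj, hcB, hcj⟩
  obtain ⟨g, hg, hgt⟩ := (Finset.all_card_le_biUnion_card_iff_exists_injective t).1 hall
  refine ⟨fun v => if hv : v ∈ I then g ⟨v, hv⟩ else v, ?_, ?_⟩
  · intro u hu v hv huv
    rw [Finset.mem_coe] at hu hv
    simp only [hu, hv, dif_pos] at huv
    simpa using hg huv
  · intro i hi
    simp only [hi, dif_pos]
    simpa [t] using hgt ⟨i, hi⟩

/-- An edge that can be added without creating matchable sets can still be added to any larger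
graph with the same matchable sets. -/
theorem Matchable.of_addEdge (hle : ∀ u v, E u v → E' u v)
    (hEE' : ∀ J, Matchable E' B J → Matchable E B J) {x y : V} (hx : x ∉ B)
    (hadd : ∀ J, Matchable (addEdge E x y) B J → Matchable E B J)
    (h : Matchable (addEdge E' x y) B I) : Matchable E' B I := by
  classical
  obtain ⟨g, hg, hI⟩ := h
  by_contra hn
  have hE : ∀ i ∈ I, i ≠ y → g i = i ∨ E' (g i) i := by
    intro i hi hiy
    rcases (hI i hi).2 with h | h | h
    · exact .inl h
    · exact .inr h
    · exact absurd h.2 hiy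
  have hsub : ∀ J ⊆ I, y ∉ J → Matchable E' B J := fun J hJ hy =>
    ⟨g, hg.mono (by exact_mod_cast hJ), fun i hi =>
      ⟨(hI i (hJ hi)).1, hE i (hJ hi) (fun h => hy (h ▸ hi))⟩⟩
  have hy : y ∈ I := by
    by_contra hy
    exact hn (hsub I subset_rfl hy)
  have hgy : g y = x := by
    by_contra hgy
    refine hn ⟨g, hg, fun i hi => ⟨(hI i hi).1, ?_⟩⟩
    rcases (hI i hi).2 with h | h | h
    · exact .inl h
    · exact .inr h
    · exact absurd (h.2 ▸ h.1) hgy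
  obtain ⟨T, hTI, hT⟩ := exists_hall_violator hn
  set N := Finset.univ.filter (fun c => c ∉ B ∧ ∃ t ∈ T, c = t ∨ E' c t) with hN
  have hTn : ¬ Matchable E' B T := by
    rintro ⟨g₀, hg₀, hT₀⟩
    rw [← Finset.card_image_of_injOn hg₀] at hT
    refine absurd (Finset.card_le_card ?_) hT.not_ge
    intro c hc
    obtain ⟨t, ht, rfl⟩ := Finset.mem_image.1 hc
    simp only [hN, Finset.mem_filter, Finset.mem_univ, true_and]
    exact ⟨(hT₀ t ht).1, t, ht, (hT₀ t ht).2⟩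
  have hyT : y ∈ T := by
    by_contra hyT
    exact hTn (hsub T hTI hyT)
  have himg : (T.erase y).image g = N := by
    refine Finset.eq_of_subset_of_card_le ?_ ?_
    · intro c hc
      obtain ⟨t, ht, rfl⟩ := Finset.mem_image.1 hc
      obtain ⟨hty, htT⟩ := Finset.mem_erase.1 ht
      simp only [hN, Finset.mem_filter, Finset.mem_univ, true_and]
      exact ⟨(hI t (hTI htT)).1, t, htT, hE t (hTI htT) hty⟩
    · rw [Finset.card_image_of_injOn, Finset.card_erase_of_mem hyT]
      · omega
      · refine hg.mono ?_
        exact_mod_cast (Finset.erase_subset _ _).trans hTI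
  have hxN : x ∉ N := by
    rw [← himg]
    intro hc
    obtain ⟨t, ht, htx⟩ := Finset.mem_image.1 hc
    obtain ⟨hty, htT⟩ := Finset.mem_erase.1 ht
    exact hty (hg (hTI htT) hy (htx.trans hgy.symm))
  obtain ⟨g₁, hg₁, hT₁⟩ := hEE' _ (hsub (T.erase y) ((Finset.erase_subset _ _).trans hTI) (by simp))
  obtain ⟨K, hTK, -, g₂, hg₂, hK⟩ := exists_perfect_matching_extension (E := E) (C := Bᶜ.erase x)
    hg₁ (by
      intro t ht
      refine ⟨Finset.mem_erase.2 ⟨?_, Finset.mem_compl.2 (hT₁ t ht).1⟩, (hT₁ t ht).2⟩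
      intro htx
      apply hxN
      simp only [hN, Finset.mem_filter, Finset.mem_univ, true_and]
      exact ⟨hx, t, Finset.mem_of_mem_erase ht, htx ▸ (hT₁ t ht).2.imp_right (hle _ _)⟩)
  have hK' : ∀ k ∈ K, g₂ k ≠ x ∧ g₂ k ∉ B ∧ (g₂ k = k ∨ E (g₂ k) k) := by
    intro k hk
    simpa [and_assoc] using hK k hk
  have hins : T ⊆ insert y K := by
    rw [← Finset.insert_erase hyT]
    exact Finset.insert_subset_insert _ hTK
  by_cases hyK : y ∈ K
  · rw [Finset.insert_eq_of_mem hyK] at hins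
    have : Matchable E B K := ⟨g₂, hg₂, fun k hk => (hK' k hk).2⟩
    exact hTn ((this.subset hins).mono_edges hle)
  · have hne : ∀ k ∈ K, k ≠ y := fun k hk h => hyK (h ▸ hk)
    have : Matchable (addEdge E x y) B (insert y K) := by
      refine ⟨Function.update g₂ y x, ?_, ?_⟩
      · intro u hu v hv huv
        rw [Finset.mem_coe, Finset.mem_insert] at hu hv
        rcases hu with rfl | hu <;> rcases hv with rfl | hv
        · rfl
        · rw [Function.update_self, Function.update_of_ne (hne v hv)] at huv
          exact absurd huv.symm (hK' v hv).1
        · rw [Function.update_self, Function.update_of_ne (hne u hu)] at huv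
          exact absurd huv (hK' u hu).1
        · rw [Function.update_of_ne (hne u hu), Function.update_of_ne (hne v hv)] at huv
          exact hg₂ hu hv huv
      · intro k hk
        rcases Finset.mem_insert.1 hk with rfl | hk
        · rw [Function.update_self]
          exact ⟨hx, .inr (.inr ⟨rfl, rfl⟩)⟩
        · rw [Function.update_of_ne (hne k hk)]
          exact ⟨(hK' k hk).2.1, (hK' k hk).2.2.imp_right .inl⟩
    exact hTn (((hadd _ this).subset hins).mono_edges hle)

end

/-- Every planted graph `(G,B)` has a unique saturation: a unique maximal planted
graph `(G̅,B)` containing `(G,B)` (same vertex set and sink set, `G ⊆ G̅`) whose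
routable sets equal those of `(G,B)`; maximality means that any planted graph
`(H,B)` with `G̅ ⊆ H` and the same routable sets as `(G,B)` equals `(G̅,B)`. -/
theorem saturation_exists_unique {V : Type*} [DecidableEq V] [Fintype V]
    (E : V → V → Prop) (B : Finset V) (hPl : IsPlanted E B) :
    ∃! Ebar : V → V → Prop,
      (∀ x y, E x y → Ebar x y) ∧
      IsPlanted Ebar B ∧
      (∀ A : Finset V, Routable Ebar B A ↔ Routable E B A) ∧
      (∀ E' : V → V → Prop, (∀ x y, Ebar x y → E' x y) → IsPlanted E' B →
        (∀ A : Finset V, Routable E' B A ↔ Routable E B A) →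
        ∀ x y, E' x y ↔ Ebar x y) := by
  let P : (V → V → Prop) → Prop := fun F =>
    (∀ x y, E x y → F x y) ∧ IsPlanted F B ∧ ∀ I, Matchable F B I ↔ Matchable E B I
  have hP : ∀ F, P F ↔ (∀ x y, E x y → F x y) ∧ IsPlanted F B ∧
      ∀ A, Routable F B A ↔ Routable E B A := fun F =>
    and_congr_right fun _ => and_congr_right fun hF =>
      (forall_routable_iff_forall_matchable hF hPl).symm
  obtain ⟨M, hM⟩ := Set.Finite.exists_maximal (Set.toFinite {F | P F})
    ⟨E, fun _ _ h => h, hPl, fun _ => Iff.rfl⟩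
  have hPM : P M := hM.prop
  have hgreatest : ∀ F, P F → ∀ x y, F x y → M x y := by
    intro F hF x y hxy
    have hx : x ∉ B := fun h => hF.2.1.2 x h y hxy
    have hne : x ≠ y := fun h => hF.2.1.1 x (by rwa [← h] at hxy)
    have hadd : ∀ J, Matchable (addEdge E x y) B J → Matchable E B J := by
      intro J hJ
      refine (hF.2.2 J).1 (hJ.mono_edges ?_)
      rintro u v (huv | ⟨rfl, rfl⟩)
      · exact hF.1 u v huv
      · exact hxy
    have hPadd : P (addEdge M x y) := by
      refine ⟨fun u v h => .inl (hPM.1 u v h), hPM.2.1.addEdge hx hne, fun J => ⟨fun hJ => ?_,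
        fun hJ => hJ.mono_edges fun u v h => .inl (hPM.1 u v h)⟩⟩
      exact (hPM.2.2 J).1 (hJ.of_addEdge hPM.1 (fun J => (hPM.2.2 J).1) hx hadd)
    exact hM.le_of_ge hPadd (fun u v h => .inl h) x y (.inr ⟨rfl, rfl⟩)
  obtain ⟨hM₁, hM₂, hM₃⟩ := (hP M).1 hPM
  refine ⟨M, ⟨hM₁, hM₂, hM₃, fun F hMF hF hR x y => ⟨?_, hMF x y⟩⟩, ?_⟩
  · exact hgreatest F ((hP F).2 ⟨fun u v h => hMF u v (hM₁ u v h), hF, hR⟩) x y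
  · rintro F ⟨hF₁, hF₂, hF₃, hF₄⟩
    funext x y
    exact propext (hF₄ M (hgreatest F ((hP F).2 ⟨hF₁, hF₂, hF₃⟩)) hM₂ hM₃ x y).symm
end

section
/- Let (G,B) be a planted graph with at least one routable set, let M be the matroid on V whose bases are the routable sets of (G,B), and let v, w be distinct vertices of G with v ∉ B and with no edge from v to w in G. Let K_v = {v} ∪ {i : e_{vi} ∈ G} be the claw of v. Then the planted graph (G ∪ e_{vw}, B) has the same routable sets as (G,B) if and only if w is a loop of the contraction M / K_v. -/
section ClawMatching

variable {V : Type*}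

/-- In a duplicate-free list, a vertex has at most one successor. -/
lemma List.Nodup.eq_of_pair_infix {l : List V} (hl : l.Nodup) {u y z : V}
    (hy : [u, y] <:+: l) (hz : [u, z] <:+: l) : y = z := by
  induction l with
  | nil => simp at hy
  | cons a l ih =>
    rw [List.nodup_cons] at hl
    have hmem : ∀ t, [u, t] <:+: l → u ∈ l := fun t h => h.subset (by simp)
    rw [List.infix_cons_iff, List.cons_prefix_cons] at hy hz
    rcases hy with ⟨rfl, hy⟩ | hy <;> rcases hz with ⟨hua, hz⟩ | hz
    · cases l with
      | nil => simp at hy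
      | cons c l => simp_all
    · exact absurd (hmem _ hz) hl.1
    · exact absurd (hua ▸ hmem _ hy) hl.1
    · exact ih hl.2 hy hz

/-- A member of a list is its head or has a predecessor. -/
lemma List.head?_eq_or_pair_infix {l : List V} {y : V} (hy : y ∈ l) :
    l.head? = some y ∨ ∃ u, [u, y] <:+: l := by
  obtain ⟨s, t, rfl⟩ := List.append_of_mem hy
  rcases List.eq_nil_or_concat s with rfl | ⟨s, u, rfl⟩
  · simp
  · exact Or.inr ⟨u, s, t, by simp⟩

/-- A member of a list is its last element or has a successor. -/
lemma List.getLast?_eq_or_pair_infix {l : List V} {u : V} (hu : u ∈ l) :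
    l.getLast? = some u ∨ ∃ y, [u, y] <:+: l := by
  obtain ⟨s, t, rfl⟩ := List.append_of_mem hu
  cases t with
  | nil => simp
  | cons y t => exact Or.inr ⟨y, s, t, by simp⟩

lemma List.IsChain.rel_of_pair_infix {E : V → V → Prop} {l : List V} (hl : l.IsChain E)
    {u y : V} (h : [u, y] <:+: l) : E u y := by
  simpa using hl.infix h

/-- Two chains of a deterministic relation with a common start which both end in a set
without outgoing edges have the same end. -/
lemma List.IsChain.getLast_eq_of_head_eq {F : V → V → Prop} {S : Set V}
    (hF : ∀ x y z, F x y → F x z → y = z) (hS : ∀ x ∈ S, ∀ y, ¬ F x y) {b c : V}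
    (hb : b ∈ S) (hc : c ∈ S) :
    ∀ (x : V) (l l' : List V), (x :: l).IsChain F → (x :: l').IsChain F →
      (x :: l).getLast? = some b → (x :: l').getLast? = some c → b = c := by
  intro x l
  induction l generalizing x with
  | nil =>
    intro l' _ h' e e'
    obtain rfl : x = b := by simpa using e
    cases l' with
    | nil => simpa using e'
    | cons y l' => exact absurd (List.isChain_cons_cons.1 h').1 (hS _ hb _)
  | cons y l ih =>
    intro l' h h' e e'
    rw [List.isChain_cons_cons] at h
    cases l' with
    | nil =>
      obtain rfl : x = c := by simpa using e'
      exact absurd h.1 (hS _ hc _)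
    | cons z l' =>
      rw [List.isChain_cons_cons] at h'
      obtain rfl := hF _ _ _ h.1 h'.1
      rw [List.getLast?_cons_cons] at e e'
      exact ih y l' h.2 h'.2 e e'

variable [DecidableEq V] [Fintype V]

/-- `σ` matches the complement of `B` bijectively to the complement of `A`, sending each vertex
to an element of its claw. -/
def IsClawMatching (E : V → V → Prop) (B A : Finset V) (σ : V → V) : Prop :=
  (∀ u, u ∉ B → σ u = u ∨ E u (σ u)) ∧ Bᶜ.image σ = Aᶜ ∧ A.card = B.card

namespace IsClawMatching

variable {E : V → V → Prop} {A B : Finset V} {σ : V → V}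

lemma injOn (h : IsClawMatching E B A σ) : Set.InjOn σ ↑(Bᶜ) := by
  apply Finset.card_image_iff.1
  rw [h.2.1, Finset.card_compl, Finset.card_compl, h.2.2]

lemma eq_of_apply_eq (h : IsClawMatching E B A σ) {x y : V} (hx : x ∉ B) (hy : y ∉ B)
    (hxy : σ x = σ y) : x = y :=
  h.injOn (by simpa using hx) (by simpa using hy) hxy

lemma exists_apply_eq (h : IsClawMatching E B A σ) {y : V} (hy : y ∉ A) :
    ∃ u, u ∉ B ∧ σ u = y := by
  have : y ∈ Bᶜ.image σ := by rw [h.2.1]; simpa using hy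
  simpa using this

lemma apply_notMem (h : IsClawMatching E B A σ) {u : V} (hu : u ∉ B) : σ u ∉ A := by
  have : σ u ∈ Aᶜ := by rw [← h.2.1]; exact Finset.mem_image_of_mem _ (by simpa using hu)
  simpa using this

/-- A claw matching is determined by covering the complement of `A`. -/
lemma of_forall_exists (hσ : ∀ u, u ∉ B → σ u = u ∨ E u (σ u)) (hcard : A.card = B.card)
    (h : ∀ y, y ∉ A → ∃ u, u ∉ B ∧ σ u = y) : IsClawMatching E B A σ := by
  refine ⟨hσ, (Finset.eq_of_subset_of_card_le ?_ ?_).symm, hcard⟩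
  · intro y hy
    simpa using h y (by simpa using hy)
  · refine Finset.card_image_le.trans ?_
    rw [Finset.card_compl, Finset.card_compl, hcard]

/-- Following the matching from non-fixed points gives a routing. -/
lemma routable (h : IsClawMatching E B A σ) : Routable E B A := by
  classical
  set F : V → V → Prop := fun x y => x ∉ B ∧ σ x = y ∧ x ≠ y with hF
  have hFE : ∀ x y, F x y → E x y := by
    rintro x y ⟨hx, rfl, hxy⟩
    exact (h.1 x hx).resolve_left (Ne.symm hxy)
  have hdet : ∀ x y z, F x y → F x z → y = z := fun x y z h1 h2 => h1.2.1.symm.trans h2.2.1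
  have hsink : ∀ x ∈ (B : Set V), ∀ y, ¬ F x y := fun x hx y h1 => h1.1 hx
  have key : ∀ b ∈ B, ∃ l : List V, l.IsChain F ∧ l.Nodup ∧ l.getLast? = some b ∧
      ∃ a ∈ A, l.head? = some a := by
    intro b hb
    let P : ℕ → Prop := fun n =>
      ∃ l : List V, l.length = n ∧ l.IsChain F ∧ l.Nodup ∧ l.getLast? = some b
    have hP1 : P 1 := ⟨[b], by simp⟩
    have hbound : ∀ n, P n → n ≤ Fintype.card V := by
      rintro n ⟨l, rfl, -, hl, -⟩
      exact hl.length_le_card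
    obtain ⟨l, hlen, hc, hnd, hlast⟩ : P (Nat.findGreatest P (Fintype.card V)) :=
      Nat.findGreatest_spec (hbound 1 hP1) hP1
    refine ⟨l, hc, hnd, hlast, ?_⟩
    cases l with
    | nil => simp at hlast
    | cons a l =>
      refine ⟨a, ?_, rfl⟩
      by_contra ha
      obtain ⟨u, hu, hua⟩ := h.exists_apply_eq ha
      have hne : u ≠ a := by
        rintro rfl
        cases l with
        | nil =>
          obtain rfl : u = b := by simpa using hlast
          exact hu hb
        | cons y l =>
          obtain ⟨-, h1, h2⟩ := (List.isChain_cons_cons.1 hc).1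
          exact h2 (hua.symm.trans h1)
      have hul : u ∉ a :: l := by
        intro hmem
        rcases List.getLast?_eq_or_pair_infix hmem with h1 | ⟨y, h1⟩
        · rw [hlast] at h1
          obtain rfl : b = u := by simpa using h1
          exact hu hb
        · obtain rfl : a = y := hua.symm.trans (hc.rel_of_pair_infix h1).2.1
          rw [List.infix_cons_iff, List.cons_prefix_cons] at h1
          rcases h1 with h1 | h1
          · exact hne h1.1
          · exact (List.nodup_cons.1 hnd).1 (h1.subset (by simp))
      have hPn : P (l.length + 1 + 1) :=
        ⟨u :: a :: l, by simp, List.isChain_cons_cons.2 ⟨⟨hu, hua, hne⟩, hc⟩,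
          List.nodup_cons.2 ⟨hul, hnd⟩, by rw [List.getLast?_cons_cons]; exact hlast⟩
      have := Nat.le_findGreatest (hbound _ hPn) hPn
      rw [← hlen] at this
      simp at this
  choose! f hc hnd hlast a haA hhead using key
  have hdisj : ∀ b ∈ B, ∀ c ∈ B, b ≠ c → ∀ v, v ∈ f b → v ∉ f c := by
    intro b hb c hc' hbc x hxb hxc
    obtain ⟨s, t, hst⟩ := List.append_of_mem hxb
    obtain ⟨s', t', hst'⟩ := List.append_of_mem hxc
    have h1 := hc b hb
    have h2 := hc c hc'
    have h3 := hlast b hb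
    have h4 := hlast c hc'
    rw [hst] at h1 h3
    rw [hst'] at h2 h4
    refine hbc (List.IsChain.getLast_eq_of_head_eq hdet hsink hb hc' x t t'
      h1.right_of_append h2.right_of_append ?_ ?_)
    · rwa [List.getLast?_append_of_ne_nil _ (by simp)] at h3
    · rwa [List.getLast?_append_of_ne_nil _ (by simp)] at h4
  have hinj : Set.InjOn a B := by
    intro b hb c hc' hbc
    by_contra hne
    refine hdisj b hb c hc' hne (a b) (List.mem_of_mem_head? (hhead b hb)) ?_
    rw [hbc]
    exact List.mem_of_mem_head? (hhead c hc')
  have himage : B.image a = A := by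
    apply Finset.eq_of_subset_of_card_le
    · intro x hx
      obtain ⟨b, hb, rfl⟩ := Finset.mem_image.1 hx
      exact haA b hb
    · rw [Finset.card_image_of_injOn hinj, h.2.2]
  refine ⟨f, fun b hb => ⟨(hc b hb).imp hFE, hnd b hb, hlast b hb⟩, hdisj, fun x => ?_⟩
  rw [← himage, Finset.mem_image]
  refine exists_congr fun b => and_congr_right fun hb => ?_
  rw [hhead b hb, Option.some_inj]

end IsClawMatching

/-- A routing yields a claw matching, sending each vertex on a path to its successor. -/
lemma Routable.exists_isClawMatching {E : V → V → Prop} {B A : Finset V} (hPl : IsPlanted E B)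
    (h : Routable E B A) : ∃ σ, IsClawMatching E B A σ := by
  classical
  obtain ⟨f, hf, hdisj, hA⟩ := h
  have hne : ∀ b ∈ B, ∃ a, (f b).head? = some a := by
    intro b hb
    have := (hf b hb).2.2
    cases hl : f b with
    | nil => simp [hl] at this
    | cons a l => exact ⟨a, rfl⟩
  choose! a ha using hne
  have hcard : A.card = B.card := by
    have hinj : Set.InjOn a B := by
      intro b hb c hc hbc
      by_contra hne
      refine hdisj b hb c hc hne (a b) (List.mem_of_mem_head? (ha b hb)) ?_
      rw [hbc]
      exact List.mem_of_mem_head? (ha c hc)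
    rw [← Finset.card_image_of_injOn hinj]
    congr 1
    ext x
    rw [hA, Finset.mem_image]
    refine exists_congr fun b => and_congr_right fun hb => ?_
    rw [ha b hb, Option.some_inj]
  let Q : V → V → Prop := fun u y => ∃ b ∈ B, [u, y] <:+: f b
  have hQE : ∀ u y, Q u y → E u y := by
    rintro u y ⟨b, hb, h⟩
    exact List.IsChain.rel_of_pair_infix (hf b hb).1 h
  have hQdet : ∀ u y z, Q u y → Q u z → y = z := by
    rintro u y z ⟨b, hb, h1⟩ ⟨c, hc, h2⟩
    obtain rfl : b = c := by
      by_contra hne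
      exact hdisj b hb c hc hne u (h1.subset (by simp)) (h2.subset (by simp))
    exact (hf b hb).2.1.eq_of_pair_infix h1 h2
  have hσ : ∀ u, ∃ y, Q u y ∨ (y = u ∧ ∀ z, ¬ Q u z) := by
    intro u
    by_cases h : ∃ y, Q u y
    · exact h.imp fun _ => Or.inl
    · exact ⟨u, Or.inr ⟨rfl, fun z hz => h ⟨z, hz⟩⟩⟩
  choose σ hσ using hσ
  refine ⟨σ, .of_forall_exists (fun u _ => ?_) hcard fun y hy => ?_⟩
  · rcases hσ u with h | h
    · exact Or.inr (hQE _ _ h)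
    · exact Or.inl h.1
  · by_cases hmem : ∃ b ∈ B, y ∈ f b
    · obtain ⟨b, hb, hyb⟩ := hmem
      rcases List.head?_eq_or_pair_infix hyb with h | ⟨u, h⟩
      · exact absurd ((hA y).2 ⟨b, hb, h⟩) hy
      · have hQ : Q u y := ⟨b, hb, h⟩
        refine ⟨u, fun hu => hPl.2 u hu y (hQE u y hQ), ?_⟩
        rcases hσ u with h' | h'
        · exact hQdet _ _ _ h' hQ
        · exact absurd hQ (h'.2 y)
    · refine ⟨y, fun hyB => hmem ⟨y, hyB, List.mem_of_getLast? (hf y hyB).2.2⟩, ?_⟩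
      rcases hσ y with ⟨b, hb, h⟩ | h
      · exact absurd ⟨b, hb, h.subset (by simp)⟩ hmem
      · exact h.1

/-- The exchange step: walk along the symmetric difference of the matchings `σ` and `τ`, starting
at `w`, until the walk meets the claw `K` of `v` or leaves the range of `τ`. The first outcome gives
a matching avoiding `w` at `v`, the second one a matching which omits `w`. -/
lemma IsClawMatching.exists_of_add_edge {E : V → V → Prop} {B A C K : Finset V} {v w : V}
    {σ τ : V → V} (hvB : v ∉ B) (hK : ∀ u, u ∈ K ↔ u = v ∨ E v u)
    (hσ : IsClawMatching (fun x y => E x y ∨ (x = v ∧ y = w)) B A σ) (hσv : σ v = w)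
    (hτ : IsClawMatching E B C τ) (hwC : w ∉ C) :
    (∃ ρ, IsClawMatching E B A ρ) ∨
      ∃ s ρ, s ∈ C ∧ s ∉ K ∧ IsClawMatching E B (insert w (C.erase s)) ρ := by
  classical
  have hσE : ∀ u, u ∉ B → u ≠ v → σ u = u ∨ E u (σ u) := by
    intro u hu huv
    rcases hσ.1 u hu with h | h | h
    · exact Or.inl h
    · exact Or.inr h
    · exact absurd h.1 huv
  by_contra hcon
  rw [not_or] at hcon
  obtain ⟨hno, hno'⟩ := hcon
  have walk : ∀ n : ℕ, ∃ (U : Finset V) (s : V), U.card = n ∧ (∀ u ∈ U, u ∉ B ∧ u ≠ v) ∧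
      s ∉ U.image τ ∧ insert s (U.image τ) = insert w (U.image σ) := by
    intro n
    induction n with
    | zero => exact ⟨∅, w, by simp⟩
    | succ n ih =>
      obtain ⟨U, s, hcard, hU, hs, heq⟩ := ih
      have heq' : ∀ y, (y = s ∨ ∃ u ∈ U, τ u = y) ↔ (y = w ∨ ∃ u ∈ U, σ u = y) := by
        intro y
        simpa using Finset.ext_iff.1 heq y
      by_cases hsK : s ∈ K
      · refine absurd ⟨fun u => if u = v then s else if u ∈ U then τ u else σ u,
          .of_forall_exists (fun u hu => ?_) hσ.2.2 fun y hy => ?_⟩ hno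
        · split_ifs with h1 h2
          · subst h1
            exact (hK s).1 hsK
          · exact hτ.1 u hu
          · exact hσE u hu h1
        · obtain ⟨u, hu, rfl⟩ := hσ.exists_apply_eq hy
          by_cases h : u = v ∨ u ∈ U
          · have : σ u = w ∨ ∃ u' ∈ U, σ u' = σ u := by
              rcases h with rfl | h
              · exact Or.inl hσv
              · exact Or.inr ⟨u, h, rfl⟩
            rcases (heq' _).2 this with h1 | ⟨u', hu', h1⟩
            · exact ⟨v, hvB, by simp [h1]⟩
            · exact ⟨u', (hU u' hu').1, by simp [hu', (hU u' hu').2, h1]⟩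
          · rw [not_or] at h
            exact ⟨u, hu, by simp [h]⟩
      by_cases hsC : s ∈ C
      · have hsw : w ≠ s := fun h => hwC (h ▸ hsC)
        refine absurd ⟨s, fun u => if u ∈ U then σ u else τ u, hsC, hsK,
          .of_forall_exists (fun u hu => ?_) ?_ fun y hy => ?_⟩ hno'
        · split_ifs with h
          · exact hσE u hu (hU u h).2
          · exact hτ.1 u hu
        · rw [Finset.card_insert_of_notMem (by simp [hwC]), Finset.card_erase_add_one hsC, hτ.2.2]
        · simp only [Finset.mem_insert, Finset.mem_erase, not_or, not_and] at hy
          have hcase : (y = s ∨ ∃ u ∈ U, τ u = y) ∨ ∃ u, u ∉ B ∧ u ∉ U ∧ τ u = y := by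
            by_cases hys : y = s
            · exact Or.inl (Or.inl hys)
            · obtain ⟨u, hu, huy⟩ := hτ.exists_apply_eq (hy.2 hys)
              by_cases huU : u ∈ U
              · exact Or.inl (Or.inr ⟨u, huU, huy⟩)
              · exact Or.inr ⟨u, hu, huU, huy⟩
          rcases hcase with h | ⟨u, hu, huU, h⟩
          · obtain ⟨u, huU, h⟩ := ((heq' y).1 h).resolve_left hy.1
            exact ⟨u, (hU u huU).1, by simp [huU, h]⟩
          · exact ⟨u, hu, by simp [huU, h]⟩
      obtain ⟨u, hu, rfl⟩ := hτ.exists_apply_eq hsC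
      have huv : u ≠ v := by
        rintro rfl
        exact hsK ((hK _).2 (hτ.1 u hu))
      have huU : u ∉ U := fun h => hs (Finset.mem_image_of_mem _ h)
      refine ⟨insert u U, σ u, by rw [Finset.card_insert_of_notMem huU, hcard], ?_, ?_, ?_⟩
      · intro x hx
        rcases Finset.mem_insert.1 hx with rfl | hx
        · exact ⟨hu, huv⟩
        · exact hU x hx
      · rw [Finset.image_insert, heq, Finset.mem_insert, not_or]
        refine ⟨fun h => huv (hσ.eq_of_apply_eq hu hvB (h.trans hσv.symm)), fun h => ?_⟩
        obtain ⟨x, hx, hxu⟩ := Finset.mem_image.1 h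
        exact huU (hσ.eq_of_apply_eq (hU x hx).1 hu hxu ▸ hx)
      · rw [Finset.image_insert, heq, Finset.image_insert, Finset.insert_comm]
  obtain ⟨U, -, hU, -⟩ := walk (Fintype.card V + 1)
  have := U.card_le_univ
  omega

end ClawMatching

/-- Let `(G,B)` be a planted graph whose routable sets are the bases of the matroid
`M = L(G,B)`, let `v ∉ B` and `w ≠ v` with no edge from `v` to `w`, and let
`K_v = {v} ∪ {u : e_{vu} ∈ G}` be the claw of `v`.  Fix a maximal independent
subset `BK` of `K_v` (a subset of `K_v` contained in some routable set, maximal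
with this property), so that the bases of the contraction `M/K_v` are the sets
`A' ⊆ V − K_v` with `A' ∪ BK` routable.  Then `(G ∪ e_{vw}, B)` has the same
routable sets as `(G,B)` if and only if `w` is a loop of `M/K_v`, i.e. `w`
belongs to no basis of `M/K_v`. -/
theorem add_edge_iff_loop_of_contraction {V : Type*} [DecidableEq V] [Fintype V]
    (E : V → V → Prop) (B : Finset V) (hPl : IsPlanted E B)
    (hne : ∃ A : Finset V, Routable E B A)
    (v w : V) (hvw : v ≠ w) (hvB : v ∉ B) (hEvw : ¬ E v w)
    (K : Finset V) (hK : ∀ u : V, u ∈ K ↔ (u = v ∨ E v u))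
    (BK : Finset V) (hBKsub : BK ⊆ K)
    (hBKind : ∃ A : Finset V, Routable E B A ∧ BK ⊆ A)
    (hBKmax : ∀ I : Finset V, I ⊆ K → (∃ A : Finset V, Routable E B A ∧ I ⊆ A) →
      BK ⊆ I → I = BK) :
    (∀ A : Finset V,
        Routable (fun x y => E x y ∨ (x = v ∧ y = w)) B A ↔ Routable E B A)
      ↔ (∀ A' : Finset V, A' ⊆ Kᶜ → Routable E B (A' ∪ BK) → w ∉ A') := by
  have hwK : w ∉ K := by
    rw [hK, not_or]
    exact ⟨hvw.symm, hEvw⟩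
  have hvBK : ∀ A, Routable E B A → BK ⊆ A → A ∩ K = BK := fun A hA hsub =>
    hBKmax _ Finset.inter_subset_right ⟨A, hA, Finset.inter_subset_left⟩
      (Finset.subset_inter hsub hBKsub)
  have hPl' : IsPlanted (fun x y => E x y ∨ (x = v ∧ y = w)) B := by
    refine ⟨fun x h => ?_, fun b hb x h => ?_⟩
    · rcases h with h | ⟨rfl, h⟩
      · exact hPl.1 x h
      · exact hvw h
    · rcases h with h | ⟨rfl, -⟩
      · exact hPl.2 b hb x h
      · exact hvB hb
  constructor
  · intro hsame A' hA'K hA' hwA'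
    obtain ⟨σ, hσ⟩ := hA'.exists_isClawMatching hPl
    have hx : σ v ∈ K := (hK _).2 (hσ.1 v hvB)
    have hxA : σ v ∉ A' ∪ BK := hσ.apply_notMem hvB
    have hnew : IsClawMatching (fun x y => E x y ∨ (x = v ∧ y = w)) B
        (insert (σ v) ((A' ∪ BK).erase w)) (Function.update σ v w) := by
      refine .of_forall_exists (fun u hu => ?_) ?_ fun y hy => ?_
      · by_cases huv : u = v
        · subst huv
          simp
        · rw [Function.update_of_ne huv]
          exact (hσ.1 u hu).imp_right Or.inl
      · rw [Finset.card_insert_of_notMem fun h => hxA (Finset.mem_of_mem_erase h),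
          Finset.card_erase_add_one (Finset.mem_union_left _ hwA'), hσ.2.2]
      · rw [Finset.mem_insert, Finset.mem_erase, not_or, not_and] at hy
        by_cases hyw : y = w
        · exact ⟨v, hvB, by simp [hyw]⟩
        · obtain ⟨u, hu, rfl⟩ := hσ.exists_apply_eq (hy.2 hyw)
          refine ⟨u, hu, Function.update_of_ne ?_ _ _⟩
          rintro rfl
          exact hy.1 rfl
    have hold := (hsame _).1 hnew.routable
    have hinter := hvBK _ hold fun x hx => Finset.mem_insert_of_mem
      (Finset.mem_erase.2 ⟨fun h => hwK (h ▸ hBKsub hx), Finset.mem_union_right _ hx⟩)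
    refine hxA (Finset.mem_union_right _ ?_)
    rw [← hinter]
    exact Finset.mem_inter.2 ⟨Finset.mem_insert_self _ _, hx⟩
  · intro hloop A
    constructor
    · intro hA
      have hrout : ∀ C, Routable E B C → BK ⊆ C → w ∉ C := by
        intro C hC hsub hwC
        refine hloop (C \ K) (fun x hx => by simpa using (Finset.mem_sdiff.1 hx).2) ?_
          (Finset.mem_sdiff.2 ⟨hwC, hwK⟩)
        rwa [← hvBK C hC hsub, Finset.sdiff_union_inter]
      obtain ⟨σ, hσ⟩ := hA.exists_isClawMatching hPl'
      by_cases hσv : σ v = w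
      · obtain ⟨C, hC, hsub⟩ := hBKind
        obtain ⟨τ, hτ⟩ := hC.exists_isClawMatching hPl
        rcases hσ.exists_of_add_edge hvB hK hσv hτ (hrout C hC hsub) with
          ⟨ρ, hρ⟩ | ⟨s, ρ, -, hsK, hρ⟩
        · exact hρ.routable
        · refine absurd (Finset.mem_insert_self _ _) (hrout _ hρ.routable fun x hx => ?_)
          exact Finset.mem_insert_of_mem
            (Finset.mem_erase.2 ⟨fun h => hsK (h ▸ hBKsub hx), hsub hx⟩)
      · refine IsClawMatching.routable (σ := σ) ⟨fun u hu => ?_, hσ.2⟩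
        rcases hσ.1 u hu with h | h | ⟨rfl, h⟩
        · exact Or.inl h
        · exact Or.inr h
        · exact absurd h hσv
    · rintro ⟨f, hf, hrest⟩
      exact ⟨f, fun b hb => ⟨List.IsChain.imp (fun _ _ => Or.inl) (hf b hb).1, (hf b hb).2⟩, hrest⟩
end

section
/- Let 𝒜 = (A_1, …, A_n) be a family of subsets of a finite set S having at least one SDR. Then there is a unique family 𝒜̅ = (A̅_1, …, A̅_n) of subsets of S such that: A_i ⊆ A̅_i for all i; 𝒜̅ has the same transversals as 𝒜; and 𝒜̅ is inclusion-maximal with this property, i.e. for any family ℬ = (B_1, …, B_n) with A̅_i ⊆ B_i for all i and with the same transversals as 𝒜, one has B_i = A̅_i for all i. -/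
open Finset

section Transversals

variable {ι S : Type*}

/-- A partial transversal of `A` is a subset of a transversal of `A`. -/
def IsPartialTransversal [DecidableEq S] [Fintype ι] (A : ι → Finset S) (X : Finset S) : Prop :=
  ∃ T, IsTransversal A T ∧ X ⊆ T

/-- Some partial transversal disjoint from `A i` is no longer a partial transversal after
inserting `x`; for `x ∉ A i` this says that `x` is not a coloop of the deletion of `A i`. -/
def IsObstructed [DecidableEq S] [Fintype ι] (A : ι → Finset S) (i : ι) (x : S) : Prop :=
  ∃ X : Finset S, (∀ y ∈ X, y ∉ A i) ∧ IsPartialTransversal A X ∧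
    ¬ IsPartialTransversal A (insert x X)

theorem IsSDR.mono {A B : ι → Finset S} {a : ι → S} (h : IsSDR A a) (hAB : ∀ i, A i ⊆ B i) :
    IsSDR B a :=
  ⟨h.1, fun i => hAB i (h.2 i)⟩

theorem IsTransversal.mono [DecidableEq S] [Fintype ι] {A B : ι → Finset S} {T : Finset S}
    (h : IsTransversal A T) (hAB : ∀ i, A i ⊆ B i) : IsTransversal B T := by
  obtain ⟨a, ha, rfl⟩ := h
  exact ⟨a, ha.mono hAB, rfl⟩

/-- Obstruction is antitone among families with the same transversals. -/
theorem IsObstructed.anti [DecidableEq S] [Fintype ι] {A B : ι → Finset S} {i : ι}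
    {x : S} (h : IsObstructed B i x) (hAB : A i ⊆ B i)
    (hT : ∀ T, IsTransversal B T ↔ IsTransversal A T) : IsObstructed A i x := by
  have hP : ∀ X, IsPartialTransversal B X ↔ IsPartialTransversal A X := fun X => by
    simp only [IsPartialTransversal, hT]
  obtain ⟨X, hXB, hX, hxX⟩ := h
  exact ⟨X, fun y hy hyA => hXB y hy (hAB hyA), (hP X).1 hX, fun h => hxX ((hP _).2 h)⟩

/-- The values of a system of representatives omitting one index extend to a transversal. -/
theorem IsSDR.exists_isSDR_forall_ne_mem_range {A : ι → Finset S} {a b : ι → S} {i : ι}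
    (ha : IsSDR A a) (hb : Function.Injective b) (hbA : ∀ j, j ≠ i → b j ∈ A j) :
    ∃ c, IsSDR A c ∧ ∀ j, j ≠ i → b j ∈ Set.range c := by
  classical
  let K : Set ι := {k | Relation.ReflTransGen (fun j k => a j = b k) i k}
  have hiK : i ∈ K := Relation.ReflTransGen.refl
  have hK : ∀ {j k}, j ∈ K → a j = b k → k ∈ K := fun hj hjk => Relation.ReflTransGen.tail hj hjk
  refine ⟨fun j => if j ∈ K then a j else b j, ⟨?_, ?_⟩, ?_⟩
  · intro j k hjk
    by_cases hj : j ∈ K <;> by_cases hk : k ∈ K <;> simp only [hj, hk, if_true, if_false] at hjk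
    · exact ha.1 hjk
    · exact absurd (hK hj hjk) hk
    · exact absurd (hK hk hjk.symm) hj
    · exact hb hjk
  · intro j
    by_cases hj : j ∈ K
    · simpa [hj] using ha.2 j
    · simpa [hj] using hbA j (fun h => hj (h ▸ hiK))
  · intro j hji
    by_cases hj : j ∈ K
    · rcases Relation.ReflTransGen.cases_tail hj with h | ⟨k, hk, hkj⟩
      · exact absurd h hji
      · exact ⟨k, by simpa [show k ∈ K from hk] using hkj⟩
    · exact ⟨j, by simp [hj]⟩

variable [DecidableEq ι] [DecidableEq S]

theorem subset_update_insert (A : ι → Finset S) (i : ι) (x : S) (j : ι) :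
    A j ⊆ Function.update A i (insert x (A i)) j := by
  by_cases h : j = i
  · subst h
    simp
  · simp [h]

variable [Fintype ι]

/-- Enlarging `A i` by an obstructed element creates a new transversal. -/
theorem IsObstructed.exists_isTransversal_update {A : ι → Finset S} {i : ι} {x : S}
    (h : IsObstructed A i x) :
    ∃ T, IsTransversal (Function.update A i (insert x (A i))) T ∧ ¬ IsTransversal A T := by
  obtain ⟨X, hXA, ⟨_, ⟨a, ha, rfl⟩, hXT⟩, hX⟩ := h
  have hxT : x ∉ univ.image a := fun hx =>
    hX ⟨_, ⟨a, ha, rfl⟩, insert_subset hx hXT⟩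
  have hax : ∀ j, a j ≠ x := fun j hj => hxT (by simp [← hj])
  refine ⟨univ.image (Function.update a i x), ⟨_, ⟨?_, ?_⟩, rfl⟩, fun hT => hX ⟨_, hT, ?_⟩⟩
  · intro j k hjk
    by_cases hj : j = i <;> by_cases hk : k = i
    · rw [hj, hk]
    · subst hj
      simp only [Function.update_self, Function.update_of_ne hk] at hjk
      exact absurd hjk.symm (hax k)
    · subst hk
      simp only [Function.update_self, Function.update_of_ne hj] at hjk
      exact absurd hjk (hax j)
    · simp only [Function.update_of_ne hj, Function.update_of_ne hk] at hjk
      exact ha.1 hjk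
  · intro j
    by_cases hj : j = i
    · subst hj
      simp
    · simpa [hj] using ha.2 j
  · refine insert_subset (mem_image.2 ⟨i, mem_univ i, by simp⟩) fun y hy => ?_
    obtain ⟨j, -, rfl⟩ := mem_image.1 (hXT hy)
    have hj : j ≠ i := by
      rintro rfl
      exact hXA _ hy (ha.2 j)
    exact mem_image.2 ⟨j, mem_univ j, by simp [hj]⟩

/-- If the values of an injective family `b` do not form a transversal of `A`, Hall's condition
fails for some set of indices. -/
theorem exists_card_biUnion_lt_of_not_isTransversal {A : ι → Finset S} {b : ι → S}
    (hb : Function.Injective b) (hT : ¬ IsTransversal A (univ.image b)) :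
    ∃ s : Finset ι, #(s.biUnion fun j => univ.filter fun k => b j ∈ A k) < #s := by
  by_contra! hall
  obtain ⟨f, hf, hfA⟩ := (all_card_le_biUnion_card_iff_exists_injective _).1 hall
  let e : ι ≃ ι := Equiv.ofBijective f (Finite.injective_iff_bijective.1 hf)
  refine hT ⟨b ∘ e.symm, ⟨hb.comp e.symm.injective, fun i => ?_⟩, ?_⟩
  · have h := hfA (e.symm i)
    rw [show f (e.symm i) = i from e.apply_symm_apply i] at h
    exact (mem_filter.1 h).2
  · ext y
    simp only [mem_image, mem_univ, true_and, Function.comp_apply]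
    exact e.symm.surjective.exists

theorem IsPartialTransversal.card_le_card_biUnion {A : ι → Finset S} {b : ι → S}
    (hb : Function.Injective b) {s : Finset ι} (hs : IsPartialTransversal A (s.image b)) :
    #s ≤ #(s.biUnion fun j => univ.filter fun k => b j ∈ A k) := by
  obtain ⟨_, ⟨c, hc, rfl⟩, hsub⟩ := hs
  have h : ∀ j, ∃ k, j ∈ s → c k = b j := fun j => by
    by_cases hj : j ∈ s
    · obtain ⟨k, -, hk⟩ := mem_image.1 (hsub (mem_image_of_mem b hj))
      exact ⟨k, fun _ => hk⟩
    · exact ⟨j, fun h => absurd h hj⟩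
  choose f hf using h
  refine card_le_card_of_injOn f (fun j hj => ?_) (fun j hj k hk hjk => ?_)
  · exact mem_biUnion.2 ⟨j, hj, mem_filter.2 ⟨mem_univ _, hf j hj ▸ hc.2 _⟩⟩
  · exact hb (by rw [← hf j hj, ← hf k hk, hjk])

/-- Enlarging `A i` by an unobstructed element creates no new transversal. -/
theorem isTransversal_of_update_of_not_isObstructed {A : ι → Finset S} {i : ι} {x : S}
    (hA : ∃ a, IsSDR A a) (hx : ¬ IsObstructed A i x) {T : Finset S}
    (hT : IsTransversal (Function.update A i (insert x (A i))) T) : IsTransversal A T := by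
  obtain ⟨a, ha⟩ := hA
  obtain ⟨b, ⟨hb, hbA⟩, rfl⟩ := hT
  have hbne : ∀ j, j ≠ i → b j ∈ A j := fun j hj => by simpa [hj] using hbA j
  have hbi : b i = x ∨ b i ∈ A i := by simpa using hbA i
  rcases hbi with rfl | hbi
  swap
  · refine ⟨b, ⟨hb, fun j => ?_⟩, rfl⟩
    by_cases hj : j = i
    · exact hj ▸ hbi
    · exact hbne j hj
  by_contra hT
  obtain ⟨s, hs⟩ := exists_card_biUnion_lt_of_not_isTransversal hb hT
  have hsub : s.erase i ⊆ s.biUnion fun j => univ.filter fun k => b j ∈ A k := fun j hj =>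
    mem_biUnion.2 ⟨j, mem_of_mem_erase hj,
      mem_filter.2 ⟨mem_univ _, hbne j (ne_of_mem_erase hj)⟩⟩
  have his : i ∈ s := by
    by_contra his
    rw [erase_eq_of_notMem his] at hsub
    exact absurd (card_le_card hsub) (not_le.2 hs)
  have heq := eq_of_subset_of_card_le hsub (by rw [card_erase_of_mem his]; omega)
  refine hx ⟨(s.erase i).image b, ?_, ?_, fun h => ?_⟩
  · intro y hy hyA
    obtain ⟨j, hj, rfl⟩ := mem_image.1 hy
    have : i ∈ s.erase i := by
      rw [heq]
      exact mem_biUnion.2 ⟨j, mem_of_mem_erase hj, mem_filter.2 ⟨mem_univ _, hyA⟩⟩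
    exact notMem_erase i s this
  · obtain ⟨c, hc, hbc⟩ := ha.exists_isSDR_forall_ne_mem_range hb hbne
    refine ⟨_, ⟨c, hc, rfl⟩, fun y hy => ?_⟩
    obtain ⟨j, hj, rfl⟩ := mem_image.1 hy
    obtain ⟨k, hk⟩ := hbc j (ne_of_mem_erase hj)
    exact mem_image.2 ⟨k, mem_univ k, hk⟩
  · rw [← image_insert, insert_erase his] at h
    exact absurd (h.card_le_card_biUnion hb) (not_le.2 hs)

/-- A maximal family with the same transversals as `A` contains every such family. -/
theorem subset_of_maximal_of_isTransversal_iff {A M B : ι → Finset S}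
    (hA : ∃ a, IsSDR A a) (hAM : ∀ i, A i ⊆ M i)
    (hM : ∀ T, IsTransversal M T ↔ IsTransversal A T)
    (hmax : ∀ C : ι → Finset S, (∀ i, M i ⊆ C i) →
      (∀ T, IsTransversal C T ↔ IsTransversal A T) → ∀ i, C i = M i)
    (hAB : ∀ i, A i ⊆ B i) (hB : ∀ T, IsTransversal B T ↔ IsTransversal A T) (i : ι) :
    B i ⊆ M i := by
  intro x hx
  have hxM : ¬ IsObstructed M i x := fun h => by
    obtain ⟨T, hT, hTA⟩ := (h.anti (hAM i) hM).exists_isTransversal_update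
    refine hTA ((hB T).1 (hT.mono fun j => ?_))
    by_cases hj : j = i
    · subst hj
      simpa using insert_subset hx (hAB j)
    · simpa [hj] using hAB j
  have hMa : ∃ a, IsSDR M a := hA.imp fun a ha => ha.mono hAM
  have h := hmax (Function.update M i (insert x (M i))) (subset_update_insert M i x)
    (fun T => ⟨fun hT => (hM T).1 (isTransversal_of_update_of_not_isObstructed hMa hxM hT),
      fun hT => ((hM T).2 hT).mono (subset_update_insert M i x)⟩) i
  rw [← h]
  simp

end Transversals

/-- A transversal matroid has a unique maximal presentation: for every family
`𝒜 = (A_1, …, A_n)` of subsets of a finite set `S` having an SDR, there is a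
unique family `𝒜̅ = (A̅_1, …, A̅_n)` with `A_i ⊆ A̅_i` for all `i`, with the same
transversals as `𝒜`, and inclusion-maximal with this property: any family
`ℬ = (B_1, …, B_n)` with `A̅_i ⊆ B_i` for all `i` and the same transversals as
`𝒜` satisfies `B_i = A̅_i` for all `i`. -/
theorem unique_maximal_presentation {S : Type*} [DecidableEq S] [Fintype S] {n : ℕ}
    (A : Fin n → Finset S) (hSDR : ∃ a : Fin n → S, IsSDR A a) :
    ∃! Abar : Fin n → Finset S,
      (∀ i, A i ⊆ Abar i) ∧
      (∀ T : Finset S, IsTransversal Abar T ↔ IsTransversal A T) ∧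
      (∀ Bfam : Fin n → Finset S, (∀ i, Abar i ⊆ Bfam i) →
        (∀ T : Finset S, IsTransversal Bfam T ↔ IsTransversal A T) →
        ∀ i, Bfam i = Abar i) := by
  classical
  have hfin : {B : Fin n → Finset S | (∀ i, A i ⊆ B i) ∧
      ∀ T, IsTransversal B T ↔ IsTransversal A T}.Finite := Set.toFinite _
  obtain ⟨M, ⟨hAM, hM⟩, hmax⟩ := hfin.exists_maximal ⟨A, fun _ => subset_rfl, fun _ => Iff.rfl⟩
  have hmax' : ∀ C : Fin n → Finset S, (∀ i, M i ⊆ C i) →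
      (∀ T, IsTransversal C T ↔ IsTransversal A T) → ∀ i, C i = M i := fun C hMC hC i =>
    (hmax ⟨fun j => (hAM j).trans (hMC j), hC⟩ hMC i).antisymm (hMC i)
  refine ⟨M, ⟨hAM, hM, hmax'⟩, fun N ⟨hAN, hN, hNmax⟩ => funext fun i => ?_⟩
  exact (subset_of_maximal_of_isTransversal_iff hSDR hAM hM hmax' hAN hN i).antisymm
    (subset_of_maximal_of_isTransversal_iff hSDR hAN hN hNmax hAM hM i)
end

section
/- (SDR exchange lemma) Let 𝒜 = (A_1, …, A_r) be a family of subsets of a finite set S satisfying the dragon marriage condition. Then for any two SDRs M and M' of 𝒜, there is a finite sequence M = M_1, M_2, …, M_s = M' of SDRs of 𝒜 such that consecutive SDRs M_i and M_{i+1} differ in exactly one position, for 1 ≤ i ≤ s−1. -/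
/-- The family `A` satisfies the dragon marriage condition: every nonempty
subfamily of `k` sets has union of cardinality at least `k + 1`. -/
def DragonMarriage {ι S : Type*} [DecidableEq S] (A : ι → Finset S) : Prop :=
  ∀ I : Finset ι, I.Nonempty → I.card + 1 ≤ (I.biUnion A).card

section

open Relation Function

variable {ι S : Type*} {A : ι → Finset S}

/-- Two SDRs of `A` are adjacent if they differ in exactly one position. -/
def SDRAdj (A : ι → Finset S) (a b : ι → S) : Prop :=
  IsSDR A a ∧ IsSDR A b ∧ ∃! i, a i ≠ b i

lemma SDRAdj.symm {a b : ι → S} (h : SDRAdj A a b) : SDRAdj A b a :=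
  ⟨h.2.1, h.1, by simpa only [ne_comm] using h.2.2⟩

lemma SDRAdj.reflTransGen_symm {a b : ι → S} (h : ReflTransGen (SDRAdj A) a b) :
    ReflTransGen (SDRAdj A) b a :=
  have : Std.Symm (SDRAdj A) := ⟨fun _ _ => SDRAdj.symm⟩
  ReflTransGen.stdSymm.symm _ _ h

lemma IsSDR.update [DecidableEq ι] {a : ι → S} (ha : IsSDR A a) {i : ι} {y : S}
    (hy : y ∈ A i) (hfree : ∀ j, a j ≠ y) : IsSDR A (update a i y) := by
  refine ⟨fun j k hjk => ?_, fun j => ?_⟩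
  · have := @ha.1 j k
    have := hfree j
    have := hfree k
    grind [Function.update_apply]
  · have := ha.2 j
    grind [Function.update_apply]

lemma IsSDR.adj_update [DecidableEq ι] {a : ι → S} (ha : IsSDR A a) {i : ι} {y : S}
    (hy : y ∈ A i) (hfree : ∀ j, a j ≠ y) : SDRAdj A a (Function.update a i y) := by
  refine ⟨ha, ha.update hy hfree, i, by simpa using hfree i, fun j hj => ?_⟩
  by_contra hji
  exact hj (by simp [hji])

lemma IsSDR.of_reflTransGen {a b : ι → S} (ha : IsSDR A a)
    (h : ReflTransGen (SDRAdj A) a b) : IsSDR A b := by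
  cases h with
  | refl => exact ha
  | tail _ h => exact h.2.1

/-- If two SDRs agree outside a nonempty set `D` of positions and occupy the same elements on `D`,
then both can be changed in the same way, outside `D` only, so that some position of `D` can be
moved to an unused element. -/
lemma DragonMarriage.exists_free [Fintype ι] [DecidableEq S]
    (hA : DragonMarriage A) (D : Finset ι) (hD : D.Nonempty) {a b : ι → S}
    (ha : IsSDR A a) (hb : IsSDR A b) (hagree : ∀ i ∉ D, a i = b i)
    (himage : ∀ j ∈ D, ∃ k ∈ D, b j = a k) :
    ∃ a' b' : ι → S, ReflTransGen (SDRAdj A) a a' ∧ ReflTransGen (SDRAdj A) b b' ∧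
      (∀ i ∈ D, a' i = a i) ∧ (∀ i ∈ D, b' i = b i) ∧ (∀ i ∉ D, a' i = b' i) ∧
      ∃ i ∈ D, ∃ y ∈ A i, ∀ j, a' j ≠ y := by
  classical
  induction hn : Fintype.card ι - D.card using Nat.strong_induction_on generalizing D with
  | _ n ih =>
  obtain ⟨x, hx, hxD⟩ : ∃ x ∈ D.biUnion A, x ∉ D.image a := by
    refine Finset.exists_mem_notMem_of_card_lt_card ?_
    have := hA D hD
    have := Finset.card_image_le (s := D) (f := a)
    omega
  obtain ⟨i, hi, hxi⟩ := Finset.mem_biUnion.1 hx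
  by_cases hfree : ∀ j, a j ≠ x
  · exact ⟨a, b, .refl, .refl, fun _ _ => rfl, fun _ _ => rfl, hagree, i, hi, x, hxi, hfree⟩
  push Not at hfree
  obtain ⟨e, rfl⟩ := hfree
  have heD : e ∉ D := fun h => hxD (Finset.mem_image_of_mem a h)
  have hcard := Finset.card_le_univ (insert e D)
  rw [Finset.card_insert_of_notMem heD] at hcard
  obtain ⟨a', b', haa', hbb', ha', hb', hab', k, hk, y, hy, hyfree⟩ :=
    ih _ (by rw [← hn, Finset.card_insert_of_notMem heD]; omega) (insert e D)
      (Finset.insert_nonempty e D) (fun i hi => hagree i (by grind)) (by grind) rfl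
  have hae : a' e = a e := ha' e (Finset.mem_insert_self e D)
  have hbe : b' e = b e := hb' e (Finset.mem_insert_self e D)
  have heab := hagree e heD
  rcases Finset.mem_insert.1 hk with rfl | hkD
  · have hyfree' : ∀ j, b' j ≠ y := by
      intro j hj
      by_cases hjD : j ∈ D
      · obtain ⟨l, hl, hjl⟩ := himage j hjD
        exact hyfree l (by rw [ha' l (by grind), ← hjl, ← hb' j (by grind), hj])
      · exact hyfree j (by grind)
    have hsa := ha.of_reflTransGen haa'
    have hsb := hb.of_reflTransGen hbb'
    refine ⟨update a' k y, update b' k y, haa'.tail (hsa.adj_update hy hyfree),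
      hbb'.tail (hsb.adj_update hy hyfree'), by grind [Function.update_apply],
      by grind [Function.update_apply], by grind [Function.update_apply],
      i, hi, a k, hxi, fun j hj => ?_⟩
    by_cases hjk : j = k
    · subst hjk
      rw [update_self] at hj
      exact hyfree j (hae.trans hj.symm)
    · rw [update_of_ne hjk, ← hae] at hj
      exact hjk (hsa.1 hj)
  · exact ⟨a', b', haa', hbb', by grind, by grind, by grind, k, hkD, y, hy, hyfree⟩

/-- Under the dragon marriage condition any two SDRs are connected by single-position changes. -/
theorem DragonMarriage.reflTransGen_sdrAdj [Fintype ι] [DecidableEq S]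
    (hA : DragonMarriage A) {a b : ι → S} (ha : IsSDR A a) (hb : IsSDR A b) :
    ReflTransGen (SDRAdj A) a b := by
  classical
  induction hn : (Finset.univ.filter fun i => a i ≠ b i).card using Nat.strong_induction_on
    generalizing a b with
  | _ n ih =>
  set D := Finset.univ.filter fun i => a i ≠ b i
  have hmem : ∀ i, i ∈ D ↔ a i ≠ b i := by simp [D]
  rcases D.eq_empty_or_nonempty with hD | hD
  · have : a = b := by
      ext i
      by_contra h
      simpa [hD] using (hmem i).2 h
    rw [this]
  by_cases hmove : ∃ i ∈ D, ∀ j, a j ≠ b i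
  · obtain ⟨i, hi, hfree⟩ := hmove
    have hadj := ha.adj_update (hb.2 i) hfree
    refine .head hadj (ih _ ?_ hadj.2.1 hb rfl)
    rw [← hn]
    refine Finset.card_lt_card (Finset.ssubset_iff_of_subset (fun j hj => ?_) |>.2 ⟨i, hi, ?_⟩)
    · rw [Finset.mem_filter] at hj
      grind [Function.update_apply]
    · simp
  push Not at hmove
  have himage : ∀ j ∈ D, ∃ k ∈ D, b j = a k := by
    intro j hj
    obtain ⟨k, hk⟩ := hmove j hj
    refine ⟨k, (hmem k).2 fun h => ?_, hk.symm⟩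
    have hkj := hb.1 (h.symm.trans hk)
    exact (hmem j).1 hj (hkj ▸ h)
  obtain ⟨a', b', haa', hbb', ha', hb', hab', i, hi, y, hy, hfree⟩ :=
    hA.exists_free D hD ha hb (fun i hi => by simpa [hmem] using hi) himage
  have himage_eq : D.image b = D.image a := by
    refine Finset.eq_of_subset_of_card_le (fun x hx => ?_) ?_
    · obtain ⟨j, hj, rfl⟩ := Finset.mem_image.1 hx
      obtain ⟨k, hk, hjk⟩ := himage j hj
      exact Finset.mem_image.2 ⟨k, hk, hjk.symm⟩
    · rw [Finset.card_image_of_injective _ ha.1, Finset.card_image_of_injective _ hb.1]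
  obtain ⟨j, hj, hji⟩ : ∃ j ∈ D, b j = a i :=
    Finset.mem_image.1 (himage_eq ▸ Finset.mem_image_of_mem a hi)
  have hne : j ≠ i := by
    rintro rfl
    exact (hmem j).1 hj hji.symm
  have hsa := ha.of_reflTransGen haa'
  have hsb := hb.of_reflTransGen hbb'
  have hadj := hsa.adj_update hy hfree
  have hfree' : ∀ k, update a' i y k ≠ b' j := by
    intro k hk
    have hbj : b' j = a' i := by rw [hb' j hj, ha' i hi, hji]
    rw [hbj] at hk
    by_cases hki : k = i
    · subst hki
      rw [update_self] at hk
      exact hfree k hk.symm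
    · rw [update_of_ne hki] at hk
      exact hki (hsa.1 hk)
  have hadj' := hadj.2.1.adj_update (hsb.2 j) hfree'
  refine ((haa'.tail hadj).tail hadj').trans (.trans (ih _ ?_ hadj'.2.1 hsb rfl)
    (SDRAdj.reflTransGen_symm hbb'))
  rw [← hn]
  refine Finset.card_lt_card (Finset.ssubset_iff_of_subset (fun k hk => ?_) |>.2 ⟨j, hj, ?_⟩)
  · by_contra hkD
    have hkj : k ≠ j := fun h => hkD (h ▸ hj)
    have hki : k ≠ i := fun h => hkD (h ▸ hi)
    simp [hkj, hki, hab' k hkD] at hk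
  · simp

end

/-- A chain of related elements can be listed as a finite sequence. -/
lemma Relation.ReflTransGen.exists_fin_seq {α : Type*} {R : α → α → Prop} {x y : α}
    (h : ReflTransGen R x y) : ∃ (s : ℕ) (f : Fin (s + 1) → α),
      f 0 = x ∧ f (Fin.last s) = y ∧ ∀ t : Fin s, R (f t.castSucc) (f t.succ) := by
  induction h using ReflTransGen.head_induction_on with
  | refl => exact ⟨0, fun _ => y, rfl, rfl, fun t => t.elim0⟩
  | @head x z hxz _ ih =>
    obtain ⟨s, f, h0, hlast, hf⟩ := ih
    refine ⟨s + 1, Fin.cons x f, rfl, by simpa [← Fin.succ_last] using hlast, fun t => ?_⟩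
    induction t using Fin.cases with
    | zero => simpa [h0] using hxz
    | succ t => simpa [← Fin.succ_castSucc] using hf t

/-- (SDR exchange lemma)  If the family `𝒜 = (A_1, …, A_r)` of subsets of a
finite set `S` satisfies the dragon marriage condition, then any two SDRs `M`
and `M'` of `𝒜` are connected by a finite sequence `M = M_1, …, M_s = M'` of
SDRs of `𝒜` in which consecutive SDRs differ in exactly one position. -/
theorem sdr_exchange {S : Type*} [DecidableEq S] [Fintype S] {r : ℕ}
    (A : Fin r → Finset S) (hDM : DragonMarriage A)
    (M M' : Fin r → S) (hM : IsSDR A M) (hM' : IsSDR A M') :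
    ∃ (s : ℕ) (Ms : Fin (s + 1) → Fin r → S),
      Ms 0 = M ∧ Ms (Fin.last s) = M' ∧
      (∀ t, IsSDR A (Ms t)) ∧
      (∀ t : Fin s, ∃! i : Fin r, Ms t.castSucc i ≠ Ms t.succ i) := by
  obtain ⟨s, f, h0, hlast, hf⟩ := (hDM.reflTransGen_sdrAdj hM hM').exists_fin_seq
  refine ⟨s, f, h0, hlast, fun t => ?_, fun t => (hf t).2.2⟩
  induction t using Fin.cases with
  | zero => exact h0 ▸ hM
  | succ t => exact (hf t).2.1
end

section
/- Let 𝒜 = (A_1, …, A_r) be a family of subsets of a finite set S having at least one SDR. If {i_1, …, i_k} ⊆ {1, …, r} is a nonempty index set with |A_{i_1} ∪ … ∪ A_{i_k}| = k, then every element of A_{i_1} ∪ … ∪ A_{i_k} belongs to every transversal of 𝒜 (i.e., the elements of this union are coloops of the transversal matroid of 𝒜). -/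
/-- Let `𝒜 = (A_1, …, A_r)` be a family of subsets of a finite set `S` having an
SDR.  If a nonempty index set `I` satisfies `|⋃_{i ∈ I} A_i| = |I|`, then every
element of `⋃_{i ∈ I} A_i` belongs to every transversal of `𝒜`; that is, the
elements of this union are coloops of the transversal matroid of `𝒜`. -/
theorem tight_union_gives_coloops {S : Type*} [DecidableEq S] [Fintype S] {r : ℕ}
    (A : Fin r → Finset S) (hSDR : ∃ a : Fin r → S, IsSDR A a)
    (I : Finset (Fin r)) (hI : I.Nonempty)
    (hcard : (I.biUnion A).card = I.card)
    (x : S) (hx : x ∈ I.biUnion A)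
    (T : Finset S) (hT : IsTransversal A T) :
    x ∈ T := by
  obtain ⟨a, ⟨ha, hmem⟩, rfl⟩ := hT
  have hsub : I.image a ⊆ I.biUnion A :=
    Finset.image_subset_iff.mpr fun i hi => Finset.mem_biUnion.mpr ⟨i, hi, hmem i⟩
  have heq : I.image a = I.biUnion A :=
    Finset.eq_of_subset_of_card_le hsub
      (by rw [hcard, Finset.card_image_of_injective I ha])
  rw [← heq] at hx
  exact Finset.image_subset_image I.subset_univ hx
end
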